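/- Weighted L^p-Poincaré inequality for log-concave weights with diameter bound (Theorem 2.4, Ferone–Nitsch–Trombetti): Let p > 1 and let ω be a positive log-concave integrable function on an open bounded convex set Ω ⊂ ℝⁿ of diameter diam(Ω). Then for every Lipschitz function u on Ω with ∫_Ω |u|^{p−2} u ω dx = 0, one has ∫_Ω |∇u|^p ω dx ≥ (π_p / diam(Ω))^p · inf_{t∈ℝ} ∫_Ω |u − t|^p ω dx. -/

import Mathlib

open MeasureTheory Real

/-- `π_p = 2π (p-1)^{1/p} / (p sin(π/p))`. -/
noncomputable def piP (p : ℝ) : ℝ :=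
  2 * Real.pi * (p - 1) ^ (1 / p) / (p * Real.sin (Real.pi / p))

/-- Evaluation of the integral that defines `π_p`, in scaled form. -/
lemma lintegral_inv_add_mul_rpow {p : ℝ} (hp : 1 < p) {μ : ℝ} (hμ : 0 < μ) :
    ∫⁻ x in Set.Ioi (0 : ℝ), ENNReal.ofReal (1 / (μ + (p - 1) * x ^ (p / (p - 1))))
      = ENNReal.ofReal (piP p / 2 * μ ^ (-(1 / p))) := by
  have hp1 : 0 < p - 1 := by linarith
  have hp0 : 0 < p := by linarith
  set q := p / (p - 1) with hq
  have hq0 : 0 < q := by positivity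
  have hqinv : 1 / q = 1 - 1 / p := by rw [hq]; field_simp
  have hq1 : 0 < 1 - 1 / q := by rw [hqinv]; simp; positivity
  have hmeas : Measurable (fun z : ℝ × ℝ =>
      ENNReal.ofReal (exp (-(μ + (p - 1) * z.1 ^ q) * z.2))) := by fun_prop
  have inner1 : ∀ x ∈ Set.Ioi (0 : ℝ), ENNReal.ofReal (1 / (μ + (p - 1) * x ^ q))
      = ∫⁻ y in Set.Ioi (0 : ℝ), ENNReal.ofReal (exp (-(μ + (p - 1) * x ^ q) * y)) := by
    intro x hx
    have hx0 : 0 < x := hx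
    have hA : 0 < μ + (p - 1) * x ^ q := by positivity
    rw [← ofReal_integral_eq_lintegral_ofReal (integrableOn_exp_mul_Ioi (by linarith) 0)
      (Filter.Eventually.of_forall fun y => (exp_pos _).le),
      integral_exp_mul_Ioi (by linarith)]
    congr 1
    simp only [mul_zero, exp_zero]
    field_simp
  have inner2 : ∀ y ∈ Set.Ioi (0 : ℝ),
      ∫⁻ x in Set.Ioi (0 : ℝ), ENNReal.ofReal (exp (-(μ + (p - 1) * x ^ q) * y))
      = ENNReal.ofReal ((p - 1) ^ (-1 / q) * Gamma (1 / q + 1)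
          * (y ^ ((1 - 1 / q) - 1) * exp (-(μ * y)))) := by
    intro y hy
    have hy0 : 0 < y := hy
    have hint : IntegrableOn (fun x : ℝ => exp (-((p - 1) * y) * x ^ q)) (Set.Ioi 0) := by
      have := integrableOn_rpow_mul_exp_neg_mul_rpow (p := q) (s := 0) (b := (p - 1) * y)
        (by norm_num) hq0 (by positivity)
      simpa using this
    have hsplit : ∀ x : ℝ, exp (-(μ + (p - 1) * x ^ q) * y)
        = exp (-(μ * y)) * exp (-((p - 1) * y) * x ^ q) := by
      intro x; rw [← exp_add]; congr 1; ring
    simp_rw [hsplit]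
    rw [← ofReal_integral_eq_lintegral_ofReal (hint.const_mul _)
      (Filter.Eventually.of_forall fun y => by positivity), integral_const_mul,
      integral_exp_neg_mul_rpow hq0 (by positivity), mul_rpow hp1.le hy0.le]
    congr 1
    rw [show (1 - 1 / q) - 1 = -1 / q by ring]
    ring
  rw [setLIntegral_congr_fun measurableSet_Ioi inner1,
    lintegral_lintegral_swap (f := fun x y => ENNReal.ofReal (exp (-(μ + (p - 1) * x ^ q) * y)))
      hmeas.aemeasurable, setLIntegral_congr_fun measurableSet_Ioi inner2]
  have hint : IntegrableOn (fun y : ℝ => y ^ ((1 - 1 / q) - 1) * exp (-(μ * y))) (Set.Ioi 0) := by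
    have := integrableOn_rpow_mul_exp_neg_mul_rpow (p := 1) (s := (1 - 1 / q) - 1) (b := μ)
        (by linarith) one_pos hμ
    simpa using this
  have hG : 0 < Gamma (1 / q + 1) := Gamma_pos_of_pos (by positivity)
  rw [← ofReal_integral_eq_lintegral_ofReal (hint.const_mul _), integral_const_mul,
    integral_rpow_mul_exp_neg_mul_Ioi hq1 hμ]
  · congr 1
    have hrefl := Real.Gamma_mul_Gamma_one_sub (1 / q)
    rw [Gamma_add_one (by positivity)]
    have hsin : sin (π * (1 / q)) = sin (π / p) := by
      rw [hqinv, show π * (1 - 1 / p) = π - π / p by ring, sin_pi_sub]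
    rw [hsin] at hrefl
    have e1 : (1 / μ) ^ (1 - 1 / q) = μ ^ (-(1 / p)) := by
      rw [hqinv, one_div, inv_rpow hμ.le, ← rpow_neg hμ.le]
      congr 1; ring
    have e2 : (p - 1) ^ (-1 / q) * (1 / q) = (p - 1) ^ (1 / p) / p := by
      have : -1 / q = 1 / p - 1 := by
        rw [show -1 / q = -(1 / q) by ring, hqinv]; ring
      rw [this, rpow_sub_one hp1.ne', hqinv]
      field_simp
    rw [e1]
    calc _ = ((p - 1) ^ (-1 / q) * (1 / q)) * (Gamma (1 / q) * Gamma (1 - 1 / q))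
          * μ ^ (-(1 / p)) := by ring
      _ = _ := by
        rw [e2, hrefl, piP]
        ring
  · filter_upwards [ae_restrict_mem measurableSet_Ioi] with y hy
    have hy0 : 0 < y := hy
    positivity

lemma exists_lt_integral_inv_add_mul_rpow {p : ℝ} (hp : 1 < p) {μ D : ℝ} (hμ : 0 < μ)
    (hD : 0 < D) (hμD : μ < (piP p / D) ^ p) :
    ∃ B : ℝ, 0 < B ∧ D / 2 < ∫ r in (0 : ℝ)..B, 1 / (μ + (p - 1) * r ^ (p / (p - 1))) := by
  have hp1 : 0 < p - 1 := by linarith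
  have hp0 : 0 < p := by linarith
  have hpi : 0 < piP p := by
    have : 0 < sin (π / p) := sin_pos_of_pos_of_lt_pi (by positivity)
      (by rw [div_lt_iff₀ hp0]; nlinarith [pi_pos])
    unfold piP
    positivity
  have hlt : D / 2 < piP p / 2 * μ ^ (-(1 / p)) := by
    have h1 : μ ^ (1 / p) < piP p / D := by
      have := rpow_lt_rpow hμ.le hμD (z := 1 / p) (by positivity)
      rwa [← rpow_mul (by positivity), mul_one_div_cancel hp0.ne', rpow_one] at this
    rw [rpow_neg hμ.le, ← div_eq_mul_inv, lt_div_iff₀ (by positivity)]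
    rw [lt_div_iff₀ hD] at h1
    linarith
  have hcont : ContinuousOn (fun r : ℝ => 1 / (μ + (p - 1) * r ^ (p / (p - 1)))) (Set.Ici 0) := by
    intro r hr
    have hr0 : (0 : ℝ) ≤ r := hr
    have : μ + (p - 1) * r ^ (p / (p - 1)) ≠ 0 := by positivity
    have h2 : ContinuousAt (fun r : ℝ => r ^ (p / (p - 1))) r :=
      continuousAt_rpow_const _ _ (Or.inr (by positivity))
    exact (continuousAt_const.div (continuousAt_const.add (continuousAt_const.mul h2))
      this).continuousWithinAt
  have hU : (⋃ n : ℕ, Set.Ioc (0 : ℝ) n) = Set.Ioi 0 := by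
    ext x
    simp only [Set.mem_iUnion, Set.mem_Ioc, Set.mem_Ioi, exists_and_left, and_iff_left_iff_imp]
    intro _
    exact exists_nat_ge x
  have hI := lintegral_inv_add_mul_rpow hp hμ
  rw [← hU, setLIntegral_iUnion_of_directed] at hI
  · have hlt' : ENNReal.ofReal (D / 2) < ENNReal.ofReal (piP p / 2 * μ ^ (-(1 / p))) :=
      (ENNReal.ofReal_lt_ofReal_iff (by linarith)).2 hlt
    rw [← hI] at hlt'
    obtain ⟨n, hn⟩ := lt_iSup_iff.1 hlt'
    have hn0 : (0 : ℝ) ≤ n := n.cast_nonneg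
    rw [← ofReal_integral_eq_lintegral_ofReal, ← intervalIntegral.integral_of_le hn0] at hn
    · have hn' := (ENNReal.ofReal_lt_ofReal_iff_of_nonneg (by positivity)).1 hn
      refine ⟨n, ?_, hn'⟩
      rcases hn0.eq_or_lt with h | h
      · rw [← h] at hn'
        simp at hn'
        linarith
      · exact h
    · exact ((hcont.mono fun x hx => hx.1).integrableOn_Icc).mono_set Set.Ioc_subset_Icc_self
    · filter_upwards [ae_restrict_mem measurableSet_Ioc] with x hx
      have : (0 : ℝ) ≤ x := hx.1.le
      positivity
  · refine Monotone.directed_le fun a b hab => Set.Ioc_subset_Ioc_right ?_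
    exact_mod_cast hab

lemma young_abs_rpow {p : ℝ} (hp : 1 < p) (x y : ℝ) {b : ℝ} (hb : 0 ≤ b) :
    p * |x| ^ (p - 2) * x * y * b ≤ |y| ^ p + (p - 1) * (|x| ^ p * b ^ (p / (p - 1))) := by
  have hp1 : 0 < p - 1 := by linarith
  have hp0 : 0 < p := by linarith
  have hpq : p.HolderConjugate (p / (p - 1)) := Real.HolderConjugate.conjExponent hp
  have h := Real.young_inequality_of_nonneg (abs_nonneg y)
    (mul_nonneg (rpow_nonneg (abs_nonneg x) (p - 1)) hb) hpq
  rw [mul_rpow (by positivity) hb, ← rpow_mul (abs_nonneg x),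
    show (p - 1) * (p / (p - 1)) = p by field_simp] at h
  have h1 : |x| ^ (p - 2) * x * y * b ≤ |y| * (|x| ^ (p - 1) * b) := by
    have e : |x| ^ (p - 2) * |x| = |x| ^ (p - 1) := by
      rcases (abs_nonneg x).eq_or_lt with h0 | h0
      · rw [← h0, zero_rpow hp1.ne', mul_zero]
      · rw [← rpow_add_one h0.ne']; congr 1; ring
    calc |x| ^ (p - 2) * x * y * b = |x| ^ (p - 2) * b * (x * y) := by ring
      _ ≤ |x| ^ (p - 2) * b * (|x| * |y|) := by
        refine mul_le_mul_of_nonneg_left ?_ (by positivity)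
        rw [← abs_mul]; exact le_abs_self _
      _ = _ := by rw [← e]; ring
  have h2 := mul_le_mul_of_nonneg_left (h1.trans h) hp0.le
  calc _ = p * (|x| ^ (p - 2) * x * y * b) := by ring
    _ ≤ _ := h2
    _ = _ := by field_simp

/-- Picone-type estimate: a nonnegative subsolution of the Riccati inequality controls the
Rayleigh quotient with Dirichlet condition at the left end and exponential weight. -/
lemma integral_rayleigh_exp_nonneg {p μ κ c s : ℝ} (hp : 1 < p) (hcs : c ≤ s)
    {v v' b b' : ℝ → ℝ} (hv : ∀ x, HasDerivAt v (v' x) x) (hv' : Continuous v') (hvc : v c = 0)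
    (hb : ContinuousOn b (Set.Icc c s)) (hbd : ∀ x ∈ Set.Ioo c s, HasDerivAt b (b' x) x)
    (hb0 : ∀ x ∈ Set.Icc c s, 0 ≤ b x)
    (hle : ∀ x ∈ Set.Ioo c s, b' x ≤ -(μ + κ * b x + (p - 1) * b x ^ (p / (p - 1)))) :
    0 ≤ ∫ x in c..s, (|v' x| ^ p - μ * |v x| ^ p) * exp (κ * x) := by
  have hp0 : 0 < p := by linarith
  have hvcont : Continuous v := continuous_iff_continuousAt.2 fun x => (hv x).continuousAt
  have habs : Continuous fun x : ℝ => |x| ^ p :=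
    continuous_abs.rpow_const fun x => Or.inr hp0.le
  have h := intervalIntegral.sub_le_integral_of_hasDeriv_right_of_le
    (g := fun x => |v x| ^ p * b x * exp (κ * x))
    (g' := fun x => ((p * |v x| ^ (p - 2) * v x * v' x) * b x + |v x| ^ p * b' x) * exp (κ * x)
      + |v x| ^ p * b x * (exp (κ * x) * (κ * 1)))
    (φ := fun x => (|v' x| ^ p - μ * |v x| ^ p) * exp (κ * x)) hcs ?_ ?_ ?_ ?_
  · refine le_trans ?_ h
    simp only [hvc, abs_zero, zero_rpow hp0.ne', zero_mul, sub_zero]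
    have := hb0 s ⟨hcs, le_rfl⟩
    positivity
  · exact ((habs.comp hvcont).continuousOn.mul hb).mul (by fun_prop)
  · intro x hx
    have h1 : HasDerivAt (fun x => |v x| ^ p) (p * |v x| ^ (p - 2) * v x * v' x) x :=
      (hasDerivAt_abs_rpow (v x) hp).comp x (hv x)
    have h2 : HasDerivAt (fun x => exp (κ * x)) (exp (κ * x) * (κ * 1)) x :=
      ((hasDerivAt_id x).const_mul κ).exp
    exact ((h1.mul (hbd x hx)).mul h2).hasDerivWithinAt
  · apply Continuous.integrableOn_Icc
    exact ((habs.comp hv').sub ((habs.comp hvcont).const_mul μ)).mul (by fun_prop)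
  · intro x hx
    have hbx := hb0 x (Set.Ioo_subset_Icc_self hx)
    have hy := young_abs_rpow hp (v x) (v' x) hbx
    have hV : 0 ≤ |v x| ^ p := by positivity
    have hr := mul_le_mul_of_nonneg_left (hle x hx) hV
    have he := exp_pos (κ * x)
    have : p * |v x| ^ (p - 2) * v x * v' x * b x + |v x| ^ p * b' x + |v x| ^ p * b x * κ
        ≤ |v' x| ^ p - μ * |v x| ^ p := by nlinarith
    calc _ = (p * |v x| ^ (p - 2) * v x * v' x * b x + |v x| ^ p * b' x + |v x| ^ p * b x * κ)
          * exp (κ * x) := by ring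
      _ ≤ _ := by gcongr

/-- Solvability of an autonomous scalar equation `b' = -P b`, started at `B`, as long as
`∫_0^B 1 / P` allows. -/
lemma exists_autonomous_solution {P : ℝ → ℝ} {B ℓ : ℝ} (hB : 0 < B)
    (hP : ContinuousOn P (Set.Icc 0 B)) (hpos : ∀ r ∈ Set.Icc 0 B, 0 < P r)
    (hℓ : ℓ ≤ ∫ r in (0 : ℝ)..B, 1 / P r) :
    ∃ b b' : ℝ → ℝ, (∀ x, HasDerivAt b (b' x) x) ∧
      ∀ x ∈ Set.Icc 0 ℓ, 0 ≤ b x ∧ b' x = -P (b x) := by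
  set Q : ℝ → ℝ := fun r => P (Set.projIcc 0 B hB.le r) with hQ
  have hQc : Continuous Q := hP.domRestrict.comp continuous_projIcc
  have hQpos : ∀ r, 0 < Q r := fun r => hpos _ (Set.projIcc 0 B hB.le r).2
  have hQeq : ∀ r ∈ Set.Icc 0 B, Q r = P r := by
    intro r hr
    simp only [hQ, Set.projIcc_of_mem hB.le hr]
  obtain ⟨M, hM⟩ := isCompact_Icc.exists_bound_of_continuousOn hP
  have hQM : ∀ r, Q r ≤ M := fun r =>
    (le_abs_self _).trans (hM _ (Set.projIcc 0 B hB.le r).2)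
  have hM0 : 0 < M := (hQpos 0).trans_le (hQM 0)
  set g : ℝ → ℝ := fun r => 1 / Q r with hg
  have hgc : Continuous g := continuous_const.div hQc fun r => (hQpos r).ne'
  set T : ℝ → ℝ := fun β => ∫ r in B..β, g r with hT
  have hTd : ∀ β, HasDerivAt T (g β) β := fun β =>
    intervalIntegral.integral_hasDerivAt_right (hgc.intervalIntegrable _ _)
      (hgc.stronglyMeasurableAtFilter _ _) hgc.continuousAt
  have hTg : ∀ x y, x ≤ y → 1 / M * (y - x) ≤ T y - T x := by
    intro x y hxy
    rw [hT]
    simp only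
    rw [intervalIntegral.integral_interval_sub_left (hgc.intervalIntegrable _ _)
      (hgc.intervalIntegrable _ _)]
    have := intervalIntegral.integral_mono_on (μ := volume) hxy (f := fun _ => 1 / M) (g := g)
      intervalIntegrable_const (hgc.intervalIntegrable _ _)
      (fun r _ => one_div_le_one_div_of_le (hQpos r) (hQM r))
    rw [intervalIntegral.integral_const, smul_eq_mul] at this
    linarith
  have hTm : StrictMono T := by
    intro x y hxy
    have := hTg x y hxy.le
    have h2 : 0 < 1 / M * (y - x) := mul_pos (by positivity) (by linarith)
    linarith
  have hTc : Continuous T := continuous_iff_continuousAt.2 fun x => (hTd x).continuousAt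
  have hsurj : Function.Surjective T := by
    apply hTc.surjective
    · have : Filter.Tendsto (fun y => 1 / M * y + T 0) Filter.atTop Filter.atTop :=
        Filter.tendsto_atTop_add_const_right _ _
          (Filter.tendsto_id.const_mul_atTop (by positivity))
      refine Filter.tendsto_atTop_mono' _ ?_ this
      filter_upwards [Filter.eventually_ge_atTop 0] with y hy
      have := hTg 0 y hy
      simp only [sub_zero] at this
      linarith
    · have : Filter.Tendsto (fun y => 1 / M * y + T 0) Filter.atBot Filter.atBot :=
        Filter.tendsto_atBot_add_const_right _ _
          (Filter.tendsto_id.const_mul_atBot (by positivity))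
      refine Filter.tendsto_atBot_mono' _ ?_ this
      filter_upwards [Filter.eventually_le_atBot 0] with y hy
      have := hTg y 0 hy
      simp only [zero_sub] at this
      linarith
  set e : ℝ ≃o ℝ := hTm.orderIsoOfSurjective T hsurj with he
  have heT : ∀ x, e x = T x := fun x => rfl
  have hTe : ∀ x, T (e.symm x) = x := fun x => e.apply_symm_apply x
  have hd : ∀ y, HasDerivAt e.symm (Q (e.symm y)) y := by
    intro y
    have := HasDerivAt.of_local_left_inverse (f := T) (g := e.symm) (a := y)
      e.symm.continuous.continuousAt (hTd _) (one_div_pos.2 (hQpos _)).ne'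
      (Filter.Eventually.of_forall hTe)
    simpa [hg] using this
  refine ⟨fun x => e.symm (-x), fun x => -Q (e.symm (-x)), ?_, ?_⟩
  · intro x
    have h := (hd (-x)).comp x (hasDerivAt_neg x)
    rwa [mul_neg_one] at h
  · intro x hx
    have h0 : T 0 ≤ -x := by
      have e1 : T 0 = -∫ r in (0 : ℝ)..B, g r := intervalIntegral.integral_symm _ _
      have e2 : ∫ r in (0 : ℝ)..B, g r = ∫ r in (0 : ℝ)..B, 1 / P r := by
        apply intervalIntegral.integral_congr
        intro r hr
        rw [Set.uIcc_of_le hB.le] at hr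
        simp only [hg, hQeq r hr]
      rw [e1, e2]
      linarith [hx.2]
    have hB' : T B = 0 := intervalIntegral.integral_same
    have l0 : 0 ≤ e.symm (-x) := by rw [e.le_symm_apply]; exact h0
    have l1 : e.symm (-x) ≤ B := by
      rw [e.symm_apply_le, heT, hB']; linarith [hx.1]
    exact ⟨l0, by simp only [hQeq _ ⟨l0, l1⟩]⟩

lemma continuousOn_riccati {p μ : ℝ} (hp : 1 < p) :
    Continuous fun r : ℝ => μ + (p - 1) * r ^ (p / (p - 1)) :=
  continuous_const.add (continuous_const.mul
    (continuous_id.rpow_const fun _ => Or.inr (div_nonneg (by linarith) (by linarith))))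

/-- Existence of subsolutions of the Riccati inequality on intervals whose length depends
affinely on the exponential rate `κ`. -/
lemma exists_riccati_subsolution {p μ B κ ℓ : ℝ} (hp : 1 < p) (hμ : 0 < μ) (hB : 0 < B)
    (hℓ : ℓ ≤ (∫ r in (0 : ℝ)..B, 1 / (μ + (p - 1) * r ^ (p / (p - 1))))
      - κ * ∫ r in (0 : ℝ)..B, r / (μ + (p - 1) * r ^ (p / (p - 1))) ^ 2) :
    ∃ b b' : ℝ → ℝ, (∀ x, HasDerivAt b (b' x) x) ∧ ∀ x ∈ Set.Icc 0 ℓ,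
      0 ≤ b x ∧ b' x ≤ -(μ + κ * b x + (p - 1) * b x ^ (p / (p - 1))) := by
  have hp1 : 0 < p - 1 := by linarith
  by_cases hstuck : ∃ r : ℝ, 0 ≤ r ∧ μ + κ * r + (p - 1) * r ^ (p / (p - 1)) ≤ 0
  · obtain ⟨r, hr, hle⟩ := hstuck
    exact ⟨fun _ => r, fun _ => 0, fun x => hasDerivAt_const x r, fun x _ => ⟨hr, by linarith⟩⟩
  · push Not at hstuck
    have hAc := continuousOn_riccati (μ := μ) hp
    set A : ℝ → ℝ := fun r => μ + (p - 1) * r ^ (p / (p - 1)) with hA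
    have hApos : ∀ r, 0 ≤ r → 0 < A r := fun r hr => by simp only [hA]; positivity
    have hPc : Continuous fun r => A r + κ * r := hAc.add (by fun_prop)
    have hPpos : ∀ r, 0 ≤ r → 0 < A r + κ * r := fun r hr => by
      have := hstuck r hr
      simp only [hA]; linarith
    have hI1 : IntervalIntegrable (fun r => 1 / A r) volume 0 B := by
      apply ContinuousOn.intervalIntegrable
      refine continuousOn_const.div hAc.continuousOn fun r hr => ?_
      rw [Set.uIcc_of_le hB.le] at hr
      exact (hApos r hr.1).ne'
    have hI2 : IntervalIntegrable (fun r => r / A r ^ 2) volume 0 B := by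
      apply ContinuousOn.intervalIntegrable
      refine continuousOn_id.div (hAc.pow 2).continuousOn fun r hr => ?_
      rw [Set.uIcc_of_le hB.le] at hr
      exact (pow_pos (hApos r hr.1) 2).ne'
    have hI3 : IntervalIntegrable (fun r => 1 / (A r + κ * r)) volume 0 B := by
      apply ContinuousOn.intervalIntegrable
      refine continuousOn_const.div hPc.continuousOn fun r hr => ?_
      rw [Set.uIcc_of_le hB.le] at hr
      exact (hPpos r hr.1).ne'
    have hkey : ℓ ≤ ∫ r in (0 : ℝ)..B, 1 / (A r + κ * r) := by
      refine hℓ.trans ?_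
      rw [← intervalIntegral.integral_const_mul,
        ← intervalIntegral.integral_sub hI1 (hI2.const_mul κ)]
      apply intervalIntegral.integral_mono_on hB.le (hI1.sub (hI2.const_mul κ)) hI3
      intro r hr
      have h1 := hApos r hr.1
      have h2 := hPpos r hr.1
      change 1 / A r - κ * (r / A r ^ 2) ≤ 1 / (A r + κ * r)
      rw [le_div_iff₀ h2, show (1 / A r - κ * (r / A r ^ 2)) * (A r + κ * r)
        = 1 - (κ * r / A r) ^ 2 by field_simp; ring]
      nlinarith [sq_nonneg (κ * r / A r)]
    obtain ⟨b, b', hb, hb2⟩ := exists_autonomous_solution hB hPc.continuousOn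
      (fun r hr => hPpos r hr.1) hkey
    refine ⟨b, b', hb, fun x hx => ⟨(hb2 x hx).1, ?_⟩⟩
    rw [(hb2 x hx).2]
    simp only [hA]
    linarith

/-- A nonnegative antitone weight preserves nonnegativity of integrals over all initial
subintervals. -/
lemma integral_mul_antitone_nonneg {c s M : ℝ} {f W : ℝ → ℝ}
    (hf : IntegrableOn f (Set.Ioc c s)) (hWm : Measurable W)
    (hW0 : ∀ x, 0 ≤ W x) (hWM : ∀ x ∈ Set.Ioc c s, W x ≤ M)
    (hanti : AntitoneOn W (Set.Ioc c s))
    (hpos : ∀ y ∈ Set.Icc c s, 0 ≤ ∫ x in c..y, f x) :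
    0 ≤ ∫ x in Set.Ioc c s, f x * W x := by
  classical
  have hrep : ∀ x ∈ Set.Ioc c s, f x * W x
      = ∫ t in Set.Ioc 0 M, f x * (if t < W x then 1 else 0) := by
    intro x hx
    rw [integral_const_mul]
    congr 1
    have : (fun t : ℝ => if t < W x then (1 : ℝ) else 0)
        = (Set.Iio (W x)).indicator fun _ => 1 := by
      ext t; simp [Set.indicator]
    rw [this, setIntegral_indicator measurableSet_Iio, setIntegral_const]
    have h2 : Set.Ioc 0 M ∩ Set.Iio (W x) = Set.Ioo 0 (W x) := by
      ext t
      simp only [Set.mem_inter_iff, Set.mem_Ioc, Set.mem_Iio, Set.mem_Ioo]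
      exact ⟨fun h => ⟨h.1.1, h.2⟩, fun h => ⟨⟨h.1, (h.2.trans_le (hWM x hx)).le⟩, h.2⟩⟩
    rw [h2]
    simp [hW0 x]
  rw [setIntegral_congr_fun measurableSet_Ioc hrep]
  rw [integral_integral_swap]
  · apply integral_nonneg
    intro t
    change 0 ≤ ∫ x in Set.Ioc c s, f x * (if t < W x then 1 else 0)
    set S : Set ℝ := {x | x ∈ Set.Ioc c s ∧ t < W x} with hS
    have hSm : MeasurableSet S := measurableSet_Ioc.inter (measurableSet_lt measurable_const hWm)
    have e1 : ∫ x in Set.Ioc c s, f x * (if t < W x then 1 else 0) = ∫ x in S, f x := by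
      have : ∀ x, f x * (if t < W x then 1 else 0) = {x | t < W x}.indicator f x := by
        intro x
        by_cases h : t < W x <;> simp [Set.indicator, h]
      simp_rw [this]
      rw [setIntegral_indicator (measurableSet_lt measurable_const hWm)]
      rfl
    rw [e1]
    rcases S.eq_empty_or_nonempty with h0 | hne
    · simp [h0]
    have hbdd : BddAbove S := ⟨s, fun x hx => hx.1.2⟩
    set y := sSup S with hy
    have hyS : y ∈ Set.Icc c s := by
      obtain ⟨x, hx⟩ := hne
      exact ⟨hx.1.1.le.trans (le_csSup hbdd hx), csSup_le ⟨x, hx⟩ fun z hz => hz.1.2⟩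
    have e2 : S =ᵐ[volume] Set.Ioc c y := by
      have hsub : S ⊆ Set.Ioc c y := fun x hx => ⟨hx.1.1, le_csSup hbdd hx⟩
      have hsub2 : Set.Ioo c y ⊆ S := by
        intro x hx
        obtain ⟨z, hz, hxz⟩ := exists_lt_of_lt_csSup hne hx.2
        have hx' : x ∈ Set.Ioc c s := ⟨hx.1, hxz.le.trans hz.1.2⟩
        exact ⟨hx', hz.2.trans_le (hanti hx' hz.1 hxz.le)⟩
      exact Filter.EventuallyLE.antisymm hsub.eventuallyLE
        (Ioo_ae_eq_Ioc.symm.le.trans hsub2.eventuallyLE)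
    rw [setIntegral_congr_set e2, ← intervalIntegral.integral_of_le hyS.1]
    exact hpos y hyS
  · have hm : Measurable fun z : ℝ × ℝ => if z.2 < W z.1 then (1 : ℝ) else 0 :=
      Measurable.ite (measurableSet_lt measurable_snd (hWm.comp measurable_fst))
        measurable_const measurable_const
    have h1 : Integrable (fun z : ℝ × ℝ => f z.1 * 1)
        ((volume.restrict (Set.Ioc c s)).prod (volume.restrict (Set.Ioc 0 M))) :=
      Integrable.mul_prod (f := f) (g := fun _ => (1 : ℝ)) hf (integrable_const _)
    refine Integrable.mono h1 ?_ ?_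
    · exact (by simpa using h1.aestronglyMeasurable : AEStronglyMeasurable
        (fun z : ℝ × ℝ => f z.1) _).mul hm.aestronglyMeasurable
    · refine Filter.Eventually.of_forall fun z => ?_
      simp only [Function.uncurry, norm_mul]
      gcongr
      split_ifs <;> simp

lemma integral_rayleigh_right_nonneg {p μ B κ c ℓ M : ℝ} (hp : 1 < p) (hμ : 0 < μ) (hB : 0 < B)
    (hcℓ : c ≤ ℓ)
    (hℓ : ℓ - c ≤ (∫ r in (0 : ℝ)..B, 1 / (μ + (p - 1) * r ^ (p / (p - 1))))
      - κ * ∫ r in (0 : ℝ)..B, r / (μ + (p - 1) * r ^ (p / (p - 1))) ^ 2)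
    {v v' w : ℝ → ℝ} (hv : ∀ x, HasDerivAt v (v' x) x) (hv' : Continuous v')
    (hwm : Measurable w) (hw0 : ∀ x, 0 ≤ w x) (hwM : ∀ x, w x ≤ M)
    (hanti : ∀ x y, c < x → x < y → w y * exp (-κ * y) ≤ w x * exp (-κ * x)) :
    0 ≤ ∫ x in c..ℓ, (|v' x| ^ p - μ * |v x - v c| ^ p) * w x := by
  have hp0 : 0 < p := by linarith
  have hM0 : 0 ≤ M := (hw0 0).trans (hwM 0)
  have hvcont : Continuous v := continuous_iff_continuousAt.2 fun x => (hv x).continuousAt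
  have habs : Continuous fun x : ℝ => |x| ^ p :=
    continuous_abs.rpow_const fun x => Or.inr hp0.le
  obtain ⟨b, b', hb, hb2⟩ := exists_riccati_subsolution hp hμ hB hℓ
  set f : ℝ → ℝ := fun x => (|v' x| ^ p - μ * |v x - v c| ^ p) * exp (κ * x) with hf
  have hfc : Continuous f := ((habs.comp hv').sub
    ((habs.comp (hvcont.sub continuous_const)).const_mul μ)).mul (by fun_prop)
  have h := integral_mul_antitone_nonneg (c := c) (s := ℓ) (f := f)
    (W := fun x => w x * exp (-κ * x)) (M := M * exp (|κ| * (|c| + |ℓ|)))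
    (hfc.integrableOn_Icc.mono_set Set.Ioc_subset_Icc_self) (by fun_prop)
    (fun x => mul_nonneg (hw0 x) (exp_pos _).le) ?_ ?_ ?_
  · rw [intervalIntegral.integral_of_le hcℓ]
    refine h.trans_eq (integral_congr_ae (Filter.Eventually.of_forall fun x => ?_))
    simp only [hf]
    rw [show ∀ A E F W : ℝ, A * E * (W * F) = A * W * (E * F) by intros; ring, ← exp_add]
    simp
  · intro x hx
    refine mul_le_mul (hwM x) (exp_le_exp.2 ?_) (exp_pos _).le hM0
    calc -κ * x ≤ |-κ * x| := le_abs_self _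
      _ = |κ| * |x| := by rw [abs_mul, abs_neg]
      _ ≤ _ := by
        gcongr
        rcases abs_cases x with h1 | h1
        · have := le_abs_self ℓ
          have := abs_nonneg c
          linarith [hx.2]
        · have := neg_abs_le c
          have := abs_nonneg ℓ
          linarith [hx.1]
  · intro x hx y hy hxy
    rcases hxy.eq_or_lt with rfl | hlt
    · exact le_rfl
    · exact hanti x y hx.1 hlt
  · intro y hy
    have hshift : ∀ x, HasDerivAt (fun x => b (x - c)) (b' (x - c)) x := fun x => by
      simpa using (hb (x - c)).comp_sub_const x c
    have := integral_rayleigh_exp_nonneg (μ := μ) (κ := κ) (v := fun x => v x - v c) (v' := v')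
      (b := fun x => b (x - c)) (b' := fun x => b' (x - c)) hp hy.1
      (fun x => (hv x).sub_const _) hv' (sub_self _)
      (fun x _ => (hshift x).continuousAt.continuousWithinAt) (fun x _ => hshift x)
      (fun x hx => (hb2 (x - c) ⟨by linarith [hx.1], by linarith [hx.2, hy.2]⟩).1)
      (fun x hx => (hb2 (x - c) ⟨by linarith [hx.1], by linarith [hx.2, hy.2]⟩).2)
    exact this

/-- A log-concave function on the line with bounded support, multiplied by the exponential of
slope `-c / a`, is unimodal with mode `c`, for a suitable `c` in the support. -/
lemma exists_unimodal_center {w : ℝ → ℝ} {ℓ M a : ℝ} (ha : 0 < a)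
    (hw0 : ∀ x, 0 ≤ w x) (hwM : ∀ x, w x ≤ M)
    (hlc : ∀ x y s t : ℝ, 0 < s → 0 < t → s + t = 1 → w x ^ s * w y ^ t ≤ w (s * x + t * y))
    (hsupp : ∀ x, ℓ < |x| → w x = 0) (hne : ∃ x, 0 < w x) :
    ∃ c ∈ Set.Icc (-ℓ) ℓ, ∀ x y, (c < x ∧ x < y) ∨ (y < x ∧ x < c) →
      w y * exp (-(c / a) * y) ≤ w x * exp (-(c / a) * x) := by
  have hlc' : ∀ x y s t : ℝ, 0 < s → 0 < t → s + t = 1 → 0 < w x → 0 < w y →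
      0 < w (s * x + t * y) ∧ s * log (w x) + t * log (w y) ≤ log (w (s * x + t * y)) := by
    intro x y s t hs ht hst hx hy
    have h := hlc x y s t hs ht hst
    have hpos : 0 < w x ^ s * w y ^ t := by positivity
    refine ⟨hpos.trans_le h, ?_⟩
    have := log_le_log hpos h
    rwa [log_mul (by positivity) (by positivity), log_rpow hx, log_rpow hy] at this
  set g : ℝ → ℝ := fun x => w x * exp (-(x ^ 2 / (2 * a))) with hg
  have hgb : BddAbove (Set.range g) := by
    refine ⟨M, ?_⟩
    rintro _ ⟨x, rfl⟩
    have h1 : exp (-(x ^ 2 / (2 * a))) ≤ 1 := exp_le_one_iff.2 (by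
      have : 0 ≤ x ^ 2 / (2 * a) := by positivity
      linarith)
    calc g x ≤ w x * 1 := mul_le_mul_of_nonneg_left h1 (hw0 x)
      _ ≤ M := by rw [mul_one]; exact hwM x
  set S := sSup (Set.range g) with hS
  have hgS : ∀ x, g x ≤ S := fun x => le_csSup hgb ⟨x, rfl⟩
  have hSpos : 0 < S := by
    obtain ⟨x, hx⟩ := hne
    exact (mul_pos hx (exp_pos _)).trans_le (hgS x)
  obtain ⟨u, -, hu, hur⟩ := exists_seq_tendsto_sSup (Set.range_nonempty g) hgb
  choose d hd using hur
  have hupos : ∀ᶠ n in Filter.atTop, 0 < u n := hu.eventually (lt_mem_nhds hSpos)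
  have hwd : ∀ᶠ n in Filter.atTop, 0 < w (d n) := by
    filter_upwards [hupos] with n hn
    rw [← hd n] at hn
    exact pos_of_mul_pos_left hn (exp_pos _).le
  have hdmem : ∀ᶠ n in Filter.atTop, d n ∈ Set.Icc (-ℓ) ℓ := by
    filter_upwards [hwd] with n hn
    by_contra hcon
    have : ℓ < |d n| := by
      by_contra h
      exact hcon (abs_le.1 (not_lt.1 h))
    rw [hsupp _ this] at hn
    exact lt_irrefl _ hn
  obtain ⟨c, hc, φ, hφ, hlim⟩ := isCompact_Icc.tendsto_subseq' hdmem.frequently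
  have hφt := hφ.tendsto_atTop
  have hwφ : ∀ᶠ n in Filter.atTop, 0 < w (d (φ n)) := hφt.eventually hwd
  set H := log S + c ^ 2 / (2 * a) with hH
  have hlimH : Filter.Tendsto (fun n => log (w (d (φ n)))) Filter.atTop (nhds H) := by
    have h1 : Filter.Tendsto (fun n => log (u (φ n)) + (d (φ n)) ^ 2 / (2 * a)) Filter.atTop
        (nhds H) :=
      ((hu.comp hφt).log hSpos.ne').add ((hlim.pow 2).div_const _)
    refine h1.congr' ?_
    filter_upwards [hwφ] with n hn
    rw [← hd (φ n)]
    simp only [hg]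
    rw [log_mul hn.ne' (exp_pos _).ne', log_exp]
    ring
  have hlogle : ∀ z, 0 < w z → log (w z) ≤ log S + z ^ 2 / (2 * a) := by
    intro z hz
    have := log_le_log (mul_pos hz (exp_pos (-(z ^ 2 / (2 * a))))) (hgS z)
    rw [log_mul hz.ne' (exp_pos _).ne', log_exp] at this
    linarith
  have hslope : ∀ y, 0 < w y → log (w y) - H ≤ c / a * (y - c) := by
    intro y hy
    have key : ∀ t ∈ Set.Ioo (0 : ℝ) 1,
        log (w y) - H ≤ c / a * (y - c) + t * ((y - c) ^ 2 / (2 * a)) := by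
      intro t ht
      have hl : (1 - t) * H + t * log (w y) ≤ log S + ((1 - t) * c + t * y) ^ 2 / (2 * a) := by
        refine le_of_tendsto_of_tendsto
          (b := Filter.atTop) ((hlimH.const_mul (1 - t)).add_const (t * log (w y)))
          (((((hlim.const_mul (1 - t)).add_const (t * y)).pow 2).div_const (2 * a)).const_add
            (log S)) ?_
        filter_upwards [hwφ] with n hn
        obtain ⟨h1, h2⟩ := hlc' (d (φ n)) y (1 - t) t (by linarith [ht.2]) ht.1 (by ring) hn hy
        exact h2.trans (hlogle _ h1)
      have e : log S = H - c ^ 2 / (2 * a) := by rw [hH]; ring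
      rw [e] at hl
      have e2 : ((1 - t) * c + t * y) ^ 2 / (2 * a) - c ^ 2 / (2 * a)
          = t * (c / a * (y - c) + t * ((y - c) ^ 2 / (2 * a))) := by
        field_simp; ring
      have : t * (log (w y) - H) ≤ t * (c / a * (y - c) + t * ((y - c) ^ 2 / (2 * a))) := by
        rw [← e2]; linarith
      exact le_of_mul_le_mul_left this ht.1
    have hlim0 : Filter.Tendsto (fun t : ℝ => c / a * (y - c) + t * ((y - c) ^ 2 / (2 * a)))
        (nhdsWithin 0 (Set.Ioi 0)) (nhds (c / a * (y - c) + 0 * ((y - c) ^ 2 / (2 * a)))) :=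
      Filter.Tendsto.mono_left (Continuous.tendsto (by fun_prop) 0) nhdsWithin_le_nhds
    rw [zero_mul, add_zero] at hlim0
    refine ge_of_tendsto hlim0 ?_
    filter_upwards [Ioo_mem_nhdsGT (zero_lt_one' ℝ)] with t ht using key t ht
  refine ⟨c, hc, fun x y hxy => ?_⟩
  rcases (hw0 y).eq_or_lt with hy | hy
  · rw [← hy, zero_mul]
    exact mul_nonneg (hw0 x) (exp_pos _).le
  have hyc : y - c ≠ 0 := by
    rcases hxy with h | h
    · exact (by linarith [h.1, h.2] : 0 < y - c).ne'
    · exact (by linarith [h.1, h.2] : y - c < 0).ne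
  set lam := (x - c) / (y - c) with hlam
  have hlam0 : 0 < lam := by
    rcases hxy with h | h
    · exact div_pos (by linarith [h.1]) (by linarith [h.1, h.2])
    · exact div_pos_of_neg_of_neg (by linarith [h.1, h.2]) (by linarith [h.1, h.2])
  have hlam1 : lam < 1 := by
    rcases hxy with h | h
    · rw [hlam, div_lt_one (by linarith [h.1, h.2])]; linarith [h.2]
    · rw [hlam, div_lt_one_of_neg (by linarith [h.1, h.2])]; linarith [h.1]
  have hlamlim : Filter.Tendsto (fun n => (x - d (φ n)) / (y - d (φ n))) Filter.atTop
      (nhds lam) := (hlim.const_sub x).div (hlim.const_sub y) hyc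
  have hev : ∀ᶠ n in Filter.atTop, 0 < w x ∧
      (1 - (x - d (φ n)) / (y - d (φ n))) * log (w (d (φ n)))
        + (x - d (φ n)) / (y - d (φ n)) * log (w y) ≤ log (w x) := by
    filter_upwards [hwφ, hlamlim.eventually (lt_mem_nhds hlam0),
      hlamlim.eventually (gt_mem_nhds hlam1),
      (hlim.const_sub y).eventually (isOpen_ne.mem_nhds hyc)] with n h1 h2 h3 h4
    have := hlc' (d (φ n)) y _ _ (sub_pos.2 h3) h2 (by ring) h1 hy
    have e : (1 - (x - d (φ n)) / (y - d (φ n))) * d (φ n)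
        + (x - d (φ n)) / (y - d (φ n)) * y = x := by
      have h4' : y - d (φ n) ≠ 0 := h4
      field_simp
      ring
    rwa [e] at this
  obtain ⟨n, hxpos, -⟩ := hev.exists
  have hfin : (1 - lam) * H + lam * log (w y) ≤ log (w x) := by
    refine le_of_tendsto (((hlamlim.const_sub 1).mul hlimH).add
      (hlamlim.mul_const (log (w y)))) ?_
    filter_upwards [hev] with n hn using hn.2
  have hsl := mul_le_mul_of_nonneg_left (hslope y hy) (sub_pos.2 hlam1).le
  have e : (1 - lam) * (c / a * (y - c)) = c / a * (y - x) := by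
    rw [hlam]; field_simp; ring
  rw [e] at hsl
  have hlog : log (w y) + -(c / a) * y ≤ log (w x) + -(c / a) * x := by
    nlinarith
  have := exp_le_exp.2 hlog
  rwa [exp_add, exp_add, exp_log hy, exp_log hxpos] at this

/-- One-dimensional weighted Poincaré inequality for log-concave weights. -/
lemma exists_integral_rayleigh_nonneg {p μ B ℓ M : ℝ} (hp : 1 < p) (hμ : 0 < μ) (hB : 0 < B)
    (hℓ0 : 0 ≤ ℓ) (hℓ : ℓ ≤ ∫ r in (0 : ℝ)..B, 1 / (μ + (p - 1) * r ^ (p / (p - 1))))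
    {v v' w : ℝ → ℝ} (hv : ∀ x, HasDerivAt v (v' x) x) (hv' : Continuous v')
    (hwm : Measurable w) (hw0 : ∀ x, 0 ≤ w x) (hwM : ∀ x, w x ≤ M)
    (hlc : ∀ x y s t : ℝ, 0 < s → 0 < t → s + t = 1 → w x ^ s * w y ^ t ≤ w (s * x + t * y))
    (hsupp : ∀ x, ℓ < |x| → w x = 0) :
    ∃ c ∈ Set.Icc (-ℓ) ℓ, 0 ≤ ∫ x, (|v' x| ^ p - μ * |v x - v c| ^ p) * w x := by
  have hp0 : 0 < p := by linarith
  by_cases hne : ∃ x, 0 < w x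
  swap
  · have hz : ∀ x, w x = 0 := fun x => le_antisymm (not_lt.1 fun h => hne ⟨x, h⟩) (hw0 x)
    exact ⟨0, ⟨by linarith, hℓ0⟩, by simp [hz]⟩
  have hAc := continuousOn_riccati (μ := μ) hp
  set a := ∫ r in (0 : ℝ)..B, r / (μ + (p - 1) * r ^ (p / (p - 1))) ^ 2 with ha
  have hp1 : 0 < p - 1 := by linarith
  have hapos : 0 < a := by
    apply intervalIntegral.intervalIntegral_pos_of_pos_on _ _ hB
    · apply ContinuousOn.intervalIntegrable
      refine continuousOn_id.div (hAc.pow 2).continuousOn fun r hr => ?_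
      rw [Set.uIcc_of_le hB.le] at hr
      have := hr.1
      positivity
    · intro r hr
      have := hr.1
      positivity
  obtain ⟨c, hc, hmode⟩ := exists_unimodal_center hapos hw0 hwM hlc hsupp hne
  refine ⟨c, hc, ?_⟩
  have hκ : c / a * a = c := div_mul_cancel₀ _ hapos.ne'
  have hvcont : Continuous v := continuous_iff_continuousAt.2 fun x => (hv x).continuousAt
  have habs : Continuous fun x : ℝ => |x| ^ p :=
    continuous_abs.rpow_const fun x => Or.inr hp0.le
  have hright := integral_rayleigh_right_nonneg (κ := c / a) hp hμ hB hc.2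
    (by rw [← ha, hκ]; linarith) hv hv' hwm hw0 hwM
    (fun x y h1 h2 => hmode x y (Or.inl ⟨h1, h2⟩))
  have hleft := integral_rayleigh_right_nonneg (κ := -(c / a)) (c := -c) (ℓ := ℓ)
    (v := fun x => v (-x)) (v' := fun x => -v' (-x)) (w := fun x => w (-x)) hp hμ hB
    (by linarith [hc.1])
    (by rw [← ha, neg_mul, hκ]; linarith)
    (fun x => by
      have h := (hv (-x)).comp x (hasDerivAt_neg x)
      rwa [mul_neg_one] at h)
    (by fun_prop) (by fun_prop) (fun x => hw0 _) (fun x => hwM _)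
    (fun x y h1 h2 => by
      have := hmode (-x) (-y) (Or.inr ⟨by linarith, by linarith⟩)
      simpa using this)
  simp only [abs_neg, neg_neg] at hleft
  rw [intervalIntegral.integral_comp_neg
    (fun x => (|v' x| ^ p - μ * |v x - v c| ^ p) * w x), neg_neg] at hleft
  have hint : ∀ s t, IntervalIntegrable
      (fun x => (|v' x| ^ p - μ * |v x - v c| ^ p) * w x) volume s t := by
    intro s t
    have h1 : IntervalIntegrable w volume s t := by
      rw [intervalIntegrable_iff]
      refine Measure.integrableOn_of_bounded (M := M) (by simp) hwm.aestronglyMeasurable ?_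
      exact Filter.Eventually.of_forall fun x => by
        rw [norm_eq_abs, abs_of_nonneg (hw0 x)]; exact hwM x
    exact h1.continuousOn_mul (((habs.comp hv').sub
      ((habs.comp (hvcont.sub continuous_const)).const_mul μ)).continuousOn)
  have hsum := add_nonneg hleft hright
  rw [intervalIntegral.integral_add_adjacent_intervals (hint _ _) (hint _ _),
    intervalIntegral.integral_of_le (by linarith), ← integral_Icc_eq_integral_Ioc] at hsum
  rwa [setIntegral_eq_integral_of_forall_compl_eq_zero] at hsum
  intro x hx
  have : ℓ < |x| := by
    by_contra h
    exact hx (abs_le.1 (not_lt.1 h))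
  rw [hsupp x this, mul_zero]

/-- Log-concavity of a nonnegative function, in multiplicative form. -/
def MulLogConcave {E : Type*} [AddCommGroup E] [Module ℝ E] (F : E → ℝ) : Prop :=
  ∀ x y : E, ∀ s t : ℝ, 0 < s → 0 < t → s + t = 1 → F x ^ s * F y ^ t ≤ F (s • x + t • y)

lemma MulLogConcave.comp_affine {E E' : Type*} [AddCommGroup E] [Module ℝ E] [AddCommGroup E']
    [Module ℝ E'] {F : E → ℝ} (hF : MulLogConcave F) (g : E' → E)
    (hg : ∀ x y : E', ∀ s t : ℝ, s + t = 1 → g (s • x + t • y) = s • g x + t • g y) :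
    MulLogConcave fun x => F (g x) := by
  intro x y s t hs ht hst
  change F (g x) ^ s * F (g y) ^ t ≤ F (g (s • x + t • y))
  rw [hg x y s t hst]
  exact hF _ _ s t hs ht hst

lemma MulLogConcave.ordConnected {f : ℝ → ℝ} (hf : MulLogConcave f) {r : ℝ} (hr : 0 ≤ r) :
    {x | r < f x}.OrdConnected := by
  refine ⟨fun x hx y hy z hz => ?_⟩
  have hx' : r < f x := hx
  have hy' : r < f y := hy
  rcases hz.1.eq_or_lt with rfl | h1
  · exact hx
  rcases hz.2.eq_or_lt with rfl | h2
  · exact hy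
  have hxy : 0 < y - x := by linarith
  have hs : 0 < (y - z) / (y - x) := div_pos (by linarith) hxy
  have ht : 0 < (z - x) / (y - x) := div_pos (by linarith) hxy
  have h := hf x y _ _ hs ht (by field_simp; ring)
  have e : ((y - z) / (y - x)) • x + ((z - x) / (y - x)) • y = z := by
    simp only [smul_eq_mul]; field_simp; ring
  rw [e] at h
  refine lt_of_lt_of_le ?_ h
  have hmin : r < min (f x) (f y) := lt_min hx' hy'
  have hm0 : 0 < min (f x) (f y) := hr.trans_lt hmin
  calc r < min (f x) (f y) := hmin
    _ = min (f x) (f y) ^ ((y - z) / (y - x)) * min (f x) (f y) ^ ((z - x) / (y - x)) := by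
      rw [← rpow_add hm0, show (y - z) / (y - x) + (z - x) / (y - x) = 1 by field_simp; ring,
        rpow_one]
    _ ≤ _ := by
      have := min_le_left (f x) (f y)
      have := min_le_right (f x) (f y)
      have hfx : 0 < f x := hr.trans_lt hx'
      gcongr

lemma MulLogConcave.measurable {f : ℝ → ℝ} (hf : MulLogConcave f) (h0 : ∀ x, 0 ≤ f x) :
    Measurable f := by
  refine measurable_of_Ioi fun r => ?_
  rcases lt_or_ge r 0 with hr | hr
  · have : f ⁻¹' Set.Ioi r = Set.univ := by
      ext x; simpa using hr.trans_le (h0 x)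
    rw [this]; exact MeasurableSet.univ
  · exact (hf.ordConnected hr).measurableSet

/-- One-dimensional Brunn–Minkowski inequality, for a target interval. -/
lemma volume_add_le_of_ordConnected {A B C : Set ℝ} {s t : ℝ} (hs : 0 < s) (ht : 0 < t)
    (hA : A.Nonempty) (hB : B.Nonempty) (hC : C.OrdConnected)
    (h : ∀ x ∈ A, ∀ y ∈ B, s * x + t * y ∈ C) :
    ENNReal.ofReal s * volume A + ENNReal.ofReal t * volume B ≤ volume C := by
  rcases eq_or_ne (volume C) ⊤ with htop | htop
  · rw [htop]; exact le_top
  set V := (volume C).toReal with hV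
  have hle : ∀ x₁ ∈ A, ∀ x₂ ∈ A, ∀ y₁ ∈ B, ∀ y₂ ∈ B, x₁ ≤ x₂ → y₁ ≤ y₂ →
      s * (x₂ - x₁) + t * (y₂ - y₁) ≤ V := by
    intro x₁ hx₁ x₂ hx₂ y₁ hy₁ y₂ hy₂ hx hy
    have hsub := hC.out (h x₁ hx₁ y₁ hy₁) (h x₂ hx₂ y₂ hy₂)
    have := ENNReal.toReal_mono htop (measure_mono (μ := volume) hsub)
    rw [Real.volume_Icc, ENNReal.toReal_ofReal] at this
    · linarith
    · have h1 := mul_le_mul_of_nonneg_left hx hs.le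
      have h2 := mul_le_mul_of_nonneg_left hy ht.le
      linarith
  have hle' : ∀ x₁ ∈ A, ∀ x₂ ∈ A, ∀ y₁ ∈ B, ∀ y₂ ∈ B, s * |x₂ - x₁| + t * |y₂ - y₁| ≤ V := by
    intro x₁ hx₁ x₂ hx₂ y₁ hy₁ y₂ hy₂
    rcases le_total x₁ x₂ with hx | hx <;> rcases le_total y₁ y₂ with hy | hy
    · rw [abs_of_nonneg (sub_nonneg.2 hx), abs_of_nonneg (sub_nonneg.2 hy)]
      exact hle _ hx₁ _ hx₂ _ hy₁ _ hy₂ hx hy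
    · rw [abs_of_nonneg (sub_nonneg.2 hx), abs_sub_comm, abs_of_nonneg (sub_nonneg.2 hy)]
      exact hle _ hx₁ _ hx₂ _ hy₂ _ hy₁ hx hy
    · rw [abs_sub_comm, abs_of_nonneg (sub_nonneg.2 hx), abs_of_nonneg (sub_nonneg.2 hy)]
      exact hle _ hx₂ _ hx₁ _ hy₁ _ hy₂ hx hy
    · rw [abs_sub_comm, abs_of_nonneg (sub_nonneg.2 hx), abs_sub_comm,
        abs_of_nonneg (sub_nonneg.2 hy)]
      exact hle _ hx₂ _ hx₁ _ hy₂ _ hy₁ hx hy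
  have hAle : ∀ y₁ ∈ B, ∀ y₂ ∈ B,
      volume A ≤ ENNReal.ofReal ((V - t * |y₂ - y₁|) / s) := by
    intro y₁ hy₁ y₂ hy₂
    refine (Real.volume_le_diam A).trans (Metric.ediam_le fun x₁ hx₁ x₂ hx₂ => ?_)
    rw [edist_dist, Real.dist_eq, abs_sub_comm]
    apply ENNReal.ofReal_le_ofReal
    rw [le_div_iff₀ hs]
    linarith [hle' x₁ hx₁ x₂ hx₂ y₁ hy₁ y₂ hy₂]
  obtain ⟨x₀, hx₀⟩ := hA
  obtain ⟨y₀, hy₀⟩ := hB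
  have hAfin : volume A ≠ ⊤ := ne_top_of_le_ne_top ENNReal.ofReal_ne_top (hAle y₀ hy₀ y₀ hy₀)
  have hBle : volume B ≤ ENNReal.ofReal ((V - s * (volume A).toReal) / t) := by
    refine (Real.volume_le_diam B).trans (Metric.ediam_le fun y₁ hy₁ y₂ hy₂ => ?_)
    rw [edist_dist, Real.dist_eq, abs_sub_comm]
    apply ENNReal.ofReal_le_ofReal
    rw [le_div_iff₀ ht]
    have h0 : 0 ≤ (V - t * |y₂ - y₁|) / s := by
      have := hle' x₀ hx₀ x₀ hx₀ y₁ hy₁ y₂ hy₂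
      rw [sub_self, abs_zero, mul_zero, zero_add] at this
      exact div_nonneg (by linarith) hs.le
    have := ENNReal.toReal_le_of_le_ofReal h0 (hAle y₁ hy₁ y₂ hy₂)
    rw [le_div_iff₀ hs] at this
    linarith
  have hBfin : volume B ≠ ⊤ := ne_top_of_le_ne_top ENNReal.ofReal_ne_top hBle
  have h0 : 0 ≤ (V - s * (volume A).toReal) / t := by
    have h1 : 0 ≤ (V - t * |y₀ - y₀|) / s := by
      have := hle' x₀ hx₀ x₀ hx₀ y₀ hy₀ y₀ hy₀
      simp only [sub_self, abs_zero, mul_zero, add_zero] at this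
      simpa using div_nonneg this hs.le
    have := ENNReal.toReal_le_of_le_ofReal h1 (hAle y₀ hy₀ y₀ hy₀)
    rw [le_div_iff₀ hs] at this
    simp only [sub_self, abs_zero, mul_zero, sub_zero] at this
    exact div_nonneg (by linarith) ht.le
  have hfin := ENNReal.toReal_le_of_le_ofReal h0 hBle
  rw [le_div_iff₀ ht] at hfin
  rw [← ENNReal.ofReal_toReal hAfin, ← ENNReal.ofReal_toReal hBfin, ← ENNReal.ofReal_toReal htop,
    ← ENNReal.ofReal_mul hs.le, ← ENNReal.ofReal_mul ht.le,
    ← ENNReal.ofReal_add (by positivity) (by positivity)]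
  apply ENNReal.ofReal_le_ofReal
  linarith

lemma add_integral_le_of_sup_eq_one {f g h : ℝ → ℝ} {s t : ℝ} (hs : 0 < s) (ht : 0 < t)
    (hst : s + t = 1) (hf0 : ∀ x, 0 ≤ f x) (hg0 : ∀ x, 0 ≤ g x)
    (hf : Integrable f) (hg : Integrable g) (hh : Integrable h)
    (hf1 : ∀ x, f x ≤ 1) (hg1 : ∀ x, g x ≤ 1)
    (hfs : ∀ r < 1, ∃ x, r < f x) (hgs : ∀ r < 1, ∃ x, r < g x)
    (hh0 : ∀ x, 0 ≤ h x) (hhc : ∀ r, 0 ≤ r → {x | r < h x}.OrdConnected)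
    (hfgh : ∀ x y, f x ^ s * g y ^ t ≤ h (s * x + t * y)) :
    s * (∫ x, f x) + t * (∫ x, g x) ≤ ∫ x, h x := by
  have key : ENNReal.ofReal s * (∫⁻ x, ENNReal.ofReal (f x))
      + ENNReal.ofReal t * (∫⁻ x, ENNReal.ofReal (g x)) ≤ ∫⁻ x, ENNReal.ofReal (h x) := by
    have hmeas : ∀ k : ℝ → ℝ, Measurable fun r : ℝ => volume {x | r < k x} := fun k =>
      Antitone.measurable fun a b hab => measure_mono fun x (hx : b < k x) => hab.trans_lt hx
    rw [lintegral_eq_lintegral_meas_lt _ (Filter.Eventually.of_forall hf0) hf.aemeasurable,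
      lintegral_eq_lintegral_meas_lt _ (Filter.Eventually.of_forall hg0) hg.aemeasurable,
      lintegral_eq_lintegral_meas_lt _ (Filter.Eventually.of_forall hh0) hh.aemeasurable,
      ← lintegral_const_mul _ (hmeas f), ← lintegral_const_mul _ (hmeas g),
      ← lintegral_add_left ((hmeas f).const_mul _)]
    refine setLIntegral_mono (hmeas h) fun r hr => ?_
    have hr0 : 0 < r := hr
    rcases lt_or_ge r 1 with h1 | h1
    · refine volume_add_le_of_ordConnected hs ht (hfs r h1) (hgs r h1) (hhc r hr0.le) ?_
      intro x hx y hy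
      have hx' : r < f x := hx
      have hy' : r < g y := hy
      refine lt_of_lt_of_le ?_ (hfgh x y)
      calc r = r ^ s * r ^ t := by rw [← rpow_add hr0, hst, rpow_one]
        _ < f x ^ s * g y ^ t := by
          have := rpow_lt_rpow hr0.le hx' hs
          have := rpow_lt_rpow hr0.le hy' ht
          gcongr
    · have e1 : {x | r < f x} = ∅ := by
        ext x; simpa using (hf1 x).trans h1
      have e2 : {x | r < g x} = ∅ := by
        ext x; simpa using (hg1 x).trans h1
      simp [e1, e2]
  rw [← ofReal_integral_eq_lintegral_ofReal hf (Filter.Eventually.of_forall hf0),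
    ← ofReal_integral_eq_lintegral_ofReal hg (Filter.Eventually.of_forall hg0),
    ← ofReal_integral_eq_lintegral_ofReal hh (Filter.Eventually.of_forall hh0),
    ← ENNReal.ofReal_mul hs.le, ← ENNReal.ofReal_mul ht.le,
    ← ENNReal.ofReal_add (mul_nonneg hs.le (integral_nonneg hf0))
      (mul_nonneg ht.le (integral_nonneg hg0))] at key
  exact (ENNReal.ofReal_le_ofReal_iff (integral_nonneg hh0)).1 key

/-- One-dimensional Prékopa–Leindler inequality. -/
lemma prekopa_leindler_one_dim {f g h : ℝ → ℝ} {s t M : ℝ} (hs : 0 < s) (ht : 0 < t)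
    (hst : s + t = 1) (hf0 : ∀ x, 0 ≤ f x) (hg0 : ∀ x, 0 ≤ g x)
    (hf : Integrable f) (hg : Integrable g) (hh : Integrable h)
    (hfM : ∀ x, f x ≤ M) (hgM : ∀ x, g x ≤ M)
    (hh0 : ∀ x, 0 ≤ h x) (hhc : ∀ r, 0 ≤ r → {x | r < h x}.OrdConnected)
    (hfgh : ∀ x y, f x ^ s * g y ^ t ≤ h (s * x + t * y)) :
    (∫ x, f x) ^ s * (∫ x, g x) ^ t ≤ ∫ x, h x := by
  have triv : ∀ k : ℝ → ℝ, (∀ x, 0 ≤ k x) → (¬ ∃ x, 0 < k x) → ∫ x, k x = 0 := by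
    intro k hk0 hk
    have : ∀ x, k x = 0 := fun x => le_antisymm (not_lt.1 fun h => hk ⟨x, h⟩) (hk0 x)
    simp [this]
  by_cases hfp : ∃ x, 0 < f x
  swap
  · rw [triv f hf0 hfp, zero_rpow hs.ne', zero_mul]
    exact integral_nonneg hh0
  by_cases hgp : ∃ x, 0 < g x
  swap
  · rw [triv g hg0 hgp, zero_rpow ht.ne', mul_zero]
    exact integral_nonneg hh0
  have sup : ∀ k : ℝ → ℝ, (∀ x, k x ≤ M) → (∃ x, 0 < k x) →
      ∃ m, 0 < m ∧ (∀ x, k x / m ≤ 1) ∧ ∀ r < 1, ∃ x, r < k x / m := by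
    intro k hk hkp
    have hb : BddAbove (Set.range k) := ⟨M, by rintro _ ⟨x, rfl⟩; exact hk x⟩
    obtain ⟨x, hx⟩ := hkp
    have hm : 0 < sSup (Set.range k) := hx.trans_le (le_csSup hb ⟨x, rfl⟩)
    refine ⟨sSup (Set.range k), hm, fun y => ?_, fun r hr => ?_⟩
    · rw [div_le_one hm]; exact le_csSup hb ⟨y, rfl⟩
    · obtain ⟨_, ⟨y, rfl⟩, hy⟩ := exists_lt_of_lt_csSup (Set.range_nonempty k)
        (show r * sSup (Set.range k) < sSup (Set.range k) by nlinarith)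
      exact ⟨y, by rwa [lt_div_iff₀ hm]⟩
  obtain ⟨a, ha, hfa, hfa'⟩ := sup f hfM hfp
  obtain ⟨b, hb, hgb, hgb'⟩ := sup g hgM hgp
  have hab : 0 < a ^ s * b ^ t := by positivity
  have key := add_integral_le_of_sup_eq_one (f := fun x => f x / a) (g := fun x => g x / b)
    (h := fun x => h x / (a ^ s * b ^ t)) hs ht hst (fun x => div_nonneg (hf0 x) ha.le)
    (fun x => div_nonneg (hg0 x) hb.le) (hf.div_const _) (hg.div_const _) (hh.div_const _)
    hfa hgb hfa' hgb' (fun x => div_nonneg (hh0 x) hab.le)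
    (fun r hr => by
      have := hhc (r * (a ^ s * b ^ t)) (by positivity)
      simpa only [lt_div_iff₀ hab] using this)
    (fun x y => by
      rw [div_rpow (hf0 x) ha.le, div_rpow (hg0 y) hb.le, div_mul_div_comm]
      exact div_le_div_of_nonneg_right (hfgh x y) hab.le)
  rw [integral_div, integral_div, integral_div] at key
  have hIf : 0 ≤ ∫ x, f x := integral_nonneg hf0
  have hIg : 0 ≤ ∫ x, g x := integral_nonneg hg0
  have am := Real.geom_mean_le_arith_mean2_weighted hs.le ht.le (div_nonneg hIf ha.le)
    (div_nonneg hIg hb.le) hst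
  rw [div_rpow hIf ha.le, div_rpow hIg hb.le, div_mul_div_comm] at am
  exact (div_le_div_iff_of_pos_right hab).1 (am.trans key)

lemma MulLogConcave.integral_snd {E : Type*} [AddCommGroup E] [Module ℝ E] {F : E × ℝ → ℝ} {M : ℝ}
    (hF : MulLogConcave F) (h0 : ∀ z, 0 ≤ F z) (hM : ∀ z, F z ≤ M)
    (hint : ∀ e, Integrable fun r => F (e, r)) :
    MulLogConcave fun e => ∫ r, F (e, r) := by
  intro x y s t hs ht hst
  refine prekopa_leindler_one_dim (M := M) hs ht hst (fun _ => h0 _) (fun _ => h0 _) (hint _)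
    (hint _) (hint _) (fun _ => hM _) (fun _ => hM _) (fun _ => h0 _) ?_ ?_
  · intro r hr
    refine MulLogConcave.ordConnected (f := fun r => F (s • x + t • y, r)) ?_ hr
    refine hF.comp_affine (fun r : ℝ => (s • x + t • y, r)) fun a b c d hcd => ?_
    ext
    · simp only [Prod.fst_add, Prod.smul_fst]
      rw [← add_smul, hcd, one_smul]
    · simp
  · intro a b
    exact hF (x, a) (y, b) s t hs ht hst

lemma integrable_of_bounded_box {k : ℕ} {f : (Fin k → ℝ) → ℝ} {M R : ℝ} (hf : Measurable f)
    (h0 : ∀ y, 0 ≤ f y) (hM : ∀ y, f y ≤ M) (hR : ∀ y, f y ≠ 0 → ∀ i, |y i| ≤ R) :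
    Integrable f ∧ ∫ y, f y ≤ M * volume.real (Set.Icc (fun _ : Fin k => -R) fun _ => R) := by
  set S := Set.Icc (fun _ : Fin k => -R) fun _ => R with hS
  have hSfin : volume S < ⊤ := isCompact_Icc.measure_lt_top
  have hsub : ∀ y, y ∉ S → f y = 0 := by
    intro y hy
    by_contra h
    exact hy ⟨fun i => (abs_le.1 (hR y h i)).1, fun i => (abs_le.1 (hR y h i)).2⟩
  have hb : ∀ y, ‖f y‖ ≤ M := fun y => by
    rw [norm_eq_abs, abs_of_nonneg (h0 y)]; exact hM y
  have hon : IntegrableOn f S := Measure.integrableOn_of_bounded hSfin.ne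
    hf.aestronglyMeasurable (Filter.Eventually.of_forall hb)
  refine ⟨(integrableOn_iff_integrable_of_support_subset fun y hy => ?_).1 hon, ?_⟩
  · by_contra h
    exact hy (hsub y h)
  · rw [← setIntegral_eq_integral_of_forall_compl_eq_zero hsub]
    exact (le_abs_self _).trans (norm_setIntegral_le_of_norm_le_const hSfin fun y _ => hb y)

/-- Prékopa's theorem for bounded functions with bounded support. -/
theorem MulLogConcave.integral_pi (k : ℕ) : ∀ {E : Type} [AddCommGroup E] [Module ℝ E]
    {F : E × (Fin k → ℝ) → ℝ} {M R : ℝ}, MulLogConcave F → (∀ z, 0 ≤ F z) → (∀ z, F z ≤ M) →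
    (∀ e y, F (e, y) ≠ 0 → ∀ i, |y i| ≤ R) → (∀ e, Measurable fun y => F (e, y)) →
    MulLogConcave fun e => ∫ y, F (e, y) := by
  induction k with
  | zero =>
    intro E _ _ F M R hF h0 hM hR hm
    have : ∀ e, ∫ y, F (e, y) = F (e, default) := by
      intro e
      rw [integral_unique]
      have : (volume : Measure (Fin 0 → ℝ)).real Set.univ = 1 := by
        simp [Measure.real, volume_pi]
      rw [this, one_smul]
      exact congrArg (fun y => F (e, y)) (Subsingleton.elim _ _)
    simp_rw [this]
    refine hF.comp_affine (fun e => (e, default)) fun a b c d _ => ?_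
    ext i
    · simp
    · exact i.elim0
  | succ k ih =>
    intro E _ _ F M R hF h0 hM hR hm
    set G : (E × ℝ) × (Fin k → ℝ) → ℝ := fun z => F (z.1.1, Fin.cons z.1.2 z.2) with hG
    have hcons : ∀ e : E, Measurable fun z : ℝ × (Fin k → ℝ) =>
        F (e, (Fin.cons z.1 z.2 : Fin (k + 1) → ℝ)) := by
      intro e
      refine (hm e).comp (measurable_pi_lambda _ fun i => ?_)
      refine Fin.cases ?_ (fun j => ?_) i
      · simpa using measurable_fst
      · simp only [Fin.cons_succ]
        fun_prop
    have hGm : ∀ e, Measurable fun y => G (e, y) := fun e =>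
      (hcons e.1).comp (measurable_prodMk_left (x := e.2))
    have hGlc : MulLogConcave G := by
      refine hF.comp_affine
        (fun z : (E × ℝ) × (Fin k → ℝ) => (z.1.1, (Fin.cons z.1.2 z.2 : Fin (k + 1) → ℝ))) ?_
      intro x y s t _
      ext i
      · simp
      · refine Fin.cases ?_ (fun j => ?_) i <;> simp
    have hGR : ∀ e y, G (e, y) ≠ 0 → ∀ i, |y i| ≤ R := fun e y h i => by
      simpa using hR _ _ h i.succ
    have hIH := ih hGlc (fun _ => h0 _) (fun _ => hM _) hGR hGm
    have hGb := fun e => integrable_of_bounded_box (hGm e) (fun _ => h0 _) (fun _ => hM _) (hGR e)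
    have hmp := (volume_preserving_piFinSuccAbove (fun _ : Fin (k + 1) => ℝ) 0).symm
    have hcomp : ∀ e : E, ∀ z : ℝ × (Fin k → ℝ),
        F (e, (MeasurableEquiv.piFinSuccAbove (fun _ : Fin (k + 1) => ℝ) 0).symm z)
          = G ((e, z.1), z.2) := fun e z => by
      simp [hG, MeasurableEquiv.piFinSuccAbove, Fin.insertNthEquiv]
    have hintF : ∀ e, Integrable fun z : ℝ × (Fin k → ℝ) => G ((e, z.1), z.2) := by
      intro e
      have h1 := (integrable_of_bounded_box (hm e) (fun _ => h0 _) (fun _ => hM _) (hR e)).1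
      have := (hmp.integrable_comp_emb (MeasurableEquiv.measurableEmbedding _)).2 h1
      refine this.congr (Filter.Eventually.of_forall fun z => ?_)
      exact hcomp e z
    have heq : ∀ e, ∫ y, F (e, y) = ∫ r, ∫ y, G ((e, r), y) := by
      intro e
      rw [← hmp.integral_comp (MeasurableEquiv.measurableEmbedding _) fun y => F (e, y)]
      simp_rw [hcomp e]
      exact integral_prod _ (hintF e)
    simp_rw [heq]
    refine MulLogConcave.integral_snd (F := fun z : E × ℝ => ∫ y, G (z, y)) hIH
      (fun z => integral_nonneg fun _ => h0 _) (fun z => (hGb z).2) fun e => ?_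
    exact (hintF e).integral_prod_left

/-- The half-space `{x | 0 ≤ cos θ (x j - a) + sin θ (x k - b)}`. -/
def coordHalfSpace {n : ℕ} (j k : Fin n) (a b θ : ℝ) : Set (EuclideanSpace ℝ (Fin n)) :=
  {x | 0 ≤ Real.cos θ * (x j - a) + Real.sin θ * (x k - b)}

lemma isClosed_coordHalfSpace {n : ℕ} (j k : Fin n) (a b θ : ℝ) :
    IsClosed (coordHalfSpace j k a b θ) :=
  isClosed_le continuous_const (by fun_prop)

lemma convex_coordHalfSpace {n : ℕ} (j k : Fin n) (a b θ : ℝ) :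
    Convex ℝ (coordHalfSpace j k a b θ) := by
  intro x hx y hy s t hs ht hst
  have hx' : 0 ≤ Real.cos θ * (x j - a) + Real.sin θ * (x k - b) := hx
  have hy' : 0 ≤ Real.cos θ * (y j - a) + Real.sin θ * (y k - b) := hy
  change 0 ≤ Real.cos θ * ((s • x + t • y) j - a) + Real.sin θ * ((s • x + t • y) k - b)
  simp only [PiLp.add_apply, PiLp.smul_apply, smul_eq_mul]
  have h1 := mul_nonneg hs hx'
  have h2 := mul_nonneg ht hy'
  obtain rfl : t = 1 - s := by linarith
  linarith

lemma volume_coordHyperplane {n : ℕ} {j k : Fin n} (hjk : j ≠ k) (a b θ : ℝ) :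
    volume {x : EuclideanSpace ℝ (Fin n) |
      Real.cos θ * (x j - a) + Real.sin θ * (x k - b) = 0} = 0 := by
  set L : EuclideanSpace ℝ (Fin n) →ₗ[ℝ] ℝ :=
    Real.cos θ • (EuclideanSpace.proj j).toLinearMap
      + Real.sin θ • (EuclideanSpace.proj k).toLinearMap with hL
  have hLx : ∀ x, L x = Real.cos θ * x j + Real.sin θ * x k := fun x => by simp [hL]
  set q : EuclideanSpace ℝ (Fin n) :=
    EuclideanSpace.single j a + EuclideanSpace.single k b with hq
  have hqj : q j = a := by simp [hq, hjk]
  have hqk : q k = b := by simp [hq, hjk.symm]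
  set S := AffineSubspace.mk' q (LinearMap.ker L) with hS
  have hmem : ∀ x, x ∈ S ↔ Real.cos θ * (x j - a) + Real.sin θ * (x k - b) = 0 := by
    intro x
    rw [hS, AffineSubspace.mem_mk', LinearMap.mem_ker, hLx]
    simp [hqj, hqk]
  have hset : {x : EuclideanSpace ℝ (Fin n) |
      Real.cos θ * (x j - a) + Real.sin θ * (x k - b) = 0} = S := by
    ext x; exact (hmem x).symm
  rw [hset]
  refine Measure.addHaar_affineSubspace volume S fun htop => ?_
  have h := (hmem (EuclideanSpace.single j (a + Real.cos θ)
    + EuclideanSpace.single k (b + Real.sin θ))).1 (htop ▸ AffineSubspace.mem_top _ _ _)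
  simp [hjk, hjk.symm] at h
  nlinarith [Real.sin_sq_add_cos_sq θ]

lemma continuous_setIntegral_coordHalfSpace {n : ℕ} {j k : Fin n} (hjk : j ≠ k) (a b : ℝ)
    {f : EuclideanSpace ℝ (Fin n) → ℝ} {K : Set (EuclideanSpace ℝ (Fin n))}
    (hf : IntegrableOn f K) :
    Continuous fun θ => ∫ x in K ∩ coordHalfSpace j k a b θ, f x := by
  have heq : ∀ θ, ∫ x in K ∩ coordHalfSpace j k a b θ, f x
      = ∫ x in K, (coordHalfSpace j k a b θ).indicator f x := fun θ =>
    (setIntegral_indicator (isClosed_coordHalfSpace j k a b θ).measurableSet).symm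
  simp_rw [heq]
  refine continuous_iff_continuousAt.2 fun θ₀ => ?_
  refine continuousAt_of_dominated (bound := fun x => ‖f x‖) ?_ ?_ hf.norm ?_
  · exact Filter.Eventually.of_forall fun θ =>
      (hf.indicator (isClosed_coordHalfSpace j k a b θ).measurableSet).aestronglyMeasurable
  · exact Filter.Eventually.of_forall fun θ => Filter.Eventually.of_forall fun x =>
      norm_indicator_le_norm_self f x
  · refine ae_restrict_of_ae ?_
    have h0 : ∀ᵐ x : EuclideanSpace ℝ (Fin n),
        Real.cos θ₀ * (x j - a) + Real.sin θ₀ * (x k - b) ≠ 0 := by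
      rw [ae_iff]
      simpa using volume_coordHyperplane hjk a b θ₀
    filter_upwards [h0] with x hx
    have hc : Continuous fun θ : ℝ => Real.cos θ * (x j - a) + Real.sin θ * (x k - b) := by
      fun_prop
    rcases lt_or_gt_of_ne hx with h | h
    · have : ∀ᶠ θ in nhds θ₀, (0 : ℝ) = (coordHalfSpace j k a b θ).indicator f x := by
        filter_upwards [hc.continuousAt.eventually_lt_const h] with θ hθ
        rw [Set.indicator_of_notMem]
        exact fun h' => absurd hθ (not_lt.2 h')
      exact continuousAt_const.congr this
    · have : ∀ᶠ θ in nhds θ₀, f x = (coordHalfSpace j k a b θ).indicator f x := by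
        filter_upwards [hc.continuousAt.eventually_const_lt h] with θ hθ
        rw [Set.indicator_of_mem]
        exact hθ.le
      exact continuousAt_const.congr this

lemma setIntegral_coordHalfSpace_add_pi {n : ℕ} {j k : Fin n} (hjk : j ≠ k) (a b θ : ℝ)
    {f : EuclideanSpace ℝ (Fin n) → ℝ} {K : Set (EuclideanSpace ℝ (Fin n))}
    (hf : IntegrableOn f K) :
    (∫ x in K ∩ coordHalfSpace j k a b θ, f x)
      + ∫ x in K ∩ coordHalfSpace j k a b (θ + Real.pi), f x = ∫ x in K, f x := by
  have hm := (isClosed_coordHalfSpace j k a b θ).measurableSet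
  rw [← integral_inter_add_sdiff hm hf]
  congr 1
  refine setIntegral_congr_set ?_
  have h0 : ∀ᵐ x : EuclideanSpace ℝ (Fin n),
      Real.cos θ * (x j - a) + Real.sin θ * (x k - b) ≠ 0 := by
    rw [ae_iff]
    simpa using volume_coordHyperplane hjk a b θ
  filter_upwards [h0] with x hx
  apply propext
  change (x ∈ K ∧ 0 ≤ Real.cos (θ + Real.pi) * (x j - a) + Real.sin (θ + Real.pi) * (x k - b))
    ↔ (x ∈ K ∧ ¬ 0 ≤ Real.cos θ * (x j - a) + Real.sin θ * (x k - b))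
  rw [Real.cos_add_pi, Real.sin_add_pi, not_le]
  refine and_congr_right fun _ => ⟨fun h => lt_of_le_of_ne (by linarith) hx, fun h => by linarith⟩

lemma exists_coordHalfSpace_split {n : ℕ} {j k : Fin n} (hjk : j ≠ k) (a b : ℝ)
    {G F : EuclideanSpace ℝ (Fin n) → ℝ} {K : Set (EuclideanSpace ℝ (Fin n))}
    (hG : IntegrableOn G K) (hF : IntegrableOn F K)
    (hG0 : ∫ x in K, G x = 0) (hF0 : ∫ x in K, F x < 0) :
    ∃ θ, ∫ x in K ∩ coordHalfSpace j k a b θ, G x = 0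
      ∧ ∫ x in K ∩ coordHalfSpace j k a b θ, F x < 0 := by
  have hc := continuous_setIntegral_coordHalfSpace hjk a b hG
  have hadd := fun θ => (setIntegral_coordHalfSpace_add_pi hjk a b θ hG).trans hG0
  have hz : ∃ θ, ∫ x in K ∩ coordHalfSpace j k a b θ, G x = 0 := by
    have h0 := hadd 0
    rw [zero_add] at h0
    rcases le_total (∫ x in K ∩ coordHalfSpace j k a b 0, G x) 0 with h | h
    · exact mem_range_of_exists_le_of_exists_ge hc ⟨0, h⟩ ⟨Real.pi, by linarith⟩
    · exact mem_range_of_exists_le_of_exists_ge hc ⟨Real.pi, by linarith⟩ ⟨0, h⟩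
  obtain ⟨θ, hθ⟩ := hz
  have hF' := setIntegral_coordHalfSpace_add_pi hjk a b θ hF
  rcases lt_or_ge (∫ x in K ∩ coordHalfSpace j k a b θ, F x) 0 with h | h
  · exact ⟨θ, hθ, h⟩
  · refine ⟨θ + Real.pi, ?_, by linarith⟩
    have := hadd θ
    linarith

lemma minor_eq_zero_of_halfSpaces {n : ℕ} {j k : Fin n} {L : Set (EuclideanSpace ℝ (Fin n))}
    (h : ∀ a b : ℚ, ∃ θ, L ⊆ coordHalfSpace j k a b θ) {x y z : EuclideanSpace ℝ (Fin n)}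
    (hx : x ∈ L) (hy : y ∈ L) (hz : z ∈ L) :
    (y j - x j) * (z k - x k) - (y k - x k) * (z j - x j) = 0 := by
  by_contra hD
  set D := (y j - x j) * (z k - x k) - (y k - x k) * (z j - x j) with hDdef
  set ly : ℝ × ℝ → ℝ := fun q => ((q.1 - x j) * (z k - x k) - (q.2 - x k) * (z j - x j)) / D
    with hly
  set lz : ℝ × ℝ → ℝ := fun q => ((y j - x j) * (q.2 - x k) - (y k - x k) * (q.1 - x j)) / D
    with hlz
  have hlyc : Continuous ly := by fun_prop
  have hlzc : Continuous lz := by fun_prop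
  set c : ℝ × ℝ := ((x j + y j + z j) / 3, (x k + y k + z k) / 3) with hc
  have hyc : ly c = 1 / 3 := by
    simp only [hly, hc]; rw [div_eq_iff hD, hDdef]; ring
  have hzc : lz c = 1 / 3 := by
    simp only [hlz, hc]; rw [div_eq_iff hD, hDdef]; ring
  have hopen : IsOpen {q : ℝ × ℝ | 0 < ly q ∧ 0 < lz q ∧ ly q + lz q < 1} :=
    (isOpen_lt continuous_const hlyc).inter ((isOpen_lt continuous_const hlzc).inter
      (isOpen_lt (hlyc.add hlzc) continuous_const))
  have hdense : DenseRange fun q : ℚ × ℚ => ((q.1 : ℝ), (q.2 : ℝ)) :=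
    Rat.denseRange_cast.prodMap Rat.denseRange_cast
  obtain ⟨⟨a, b⟩, h1, h2, h3⟩ := hdense.exists_mem_open hopen ⟨c, by
    simp only [Set.mem_ofPred_eq, hyc, hzc]; norm_num⟩
  obtain ⟨θ, hθ⟩ := h a b
  have hx' : 0 ≤ Real.cos θ * (x j - a) + Real.sin θ * (x k - b) := hθ hx
  have hy' : 0 ≤ Real.cos θ * (y j - a) + Real.sin θ * (y k - b) := hθ hy
  have hz' : 0 ≤ Real.cos θ * (z j - a) + Real.sin θ * (z k - b) := hθ hz
  set α := ly ((a : ℝ), (b : ℝ)) with hα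
  set β := lz ((a : ℝ), (b : ℝ)) with hβ
  have ha : (a : ℝ) = x j + α * (y j - x j) + β * (z j - x j) := by
    rw [hα, hβ, hly, hlz]; field_simp; rw [hDdef]; ring
  have hb : (b : ℝ) = x k + α * (y k - x k) + β * (z k - x k) := by
    rw [hα, hβ, hly, hlz]; field_simp; rw [hDdef]; ring
  have hsum : (1 - α - β) * (Real.cos θ * (x j - a) + Real.sin θ * (x k - b))
      + α * (Real.cos θ * (y j - a) + Real.sin θ * (y k - b))
      + β * (Real.cos θ * (z j - a) + Real.sin θ * (z k - b)) = 0 := by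
    rw [ha, hb]; ring
  have h1' : 0 < α := h1
  have h2' : 0 < β := h2
  have h3' : 0 < 1 - α - β := by
    have : α + β < 1 := h3
    linarith
  have px := mul_nonneg h3'.le hx'
  have py := mul_nonneg h1'.le hy'
  have pz := mul_nonneg h2'.le hz'
  have zx := (mul_eq_zero.1 (show _ = (0 : ℝ) by linarith : (1 - α - β) *
    (Real.cos θ * (x j - a) + Real.sin θ * (x k - b)) = 0)).resolve_left h3'.ne'
  have zy := (mul_eq_zero.1 (show _ = (0 : ℝ) by linarith : α *
    (Real.cos θ * (y j - a) + Real.sin θ * (y k - b)) = 0)).resolve_left h1'.ne'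
  have zz := (mul_eq_zero.1 (show _ = (0 : ℝ) by linarith : β *
    (Real.cos θ * (z j - a) + Real.sin θ * (z k - b)) = 0)).resolve_left h2'.ne'
  have ey : Real.cos θ * (y j - x j) + Real.sin θ * (y k - x k) = 0 := by linarith
  have ez : Real.cos θ * (z j - x j) + Real.sin θ * (z k - x k) = 0 := by linarith
  have hcos : Real.cos θ * D = 0 := by
    rw [hDdef]; linear_combination (z k - x k) * ey - (y k - x k) * ez
  have hsin : Real.sin θ * D = 0 := by
    rw [hDdef]; linear_combination (y j - x j) * ez - (z j - x j) * ey
  have hc0 := (mul_eq_zero.1 hcos).resolve_right hD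
  have hs0 := (mul_eq_zero.1 hsin).resolve_right hD
  have := Real.sin_sq_add_cos_sq θ
  rw [hc0, hs0] at this
  norm_num at this

lemma exists_unit_of_halfSpaces {n : ℕ} (hn : 0 < n) {L : Set (EuclideanSpace ℝ (Fin n))}
    (h : ∀ j k, j ≠ k → ∀ a b : ℚ, ∃ θ, L ⊆ coordHalfSpace j k a b θ)
    {x : EuclideanSpace ℝ (Fin n)} (hx : x ∈ L) :
    ∃ e : EuclideanSpace ℝ (Fin n), ‖e‖ = 1 ∧ ∀ z ∈ L, ∃ s : ℝ, z - x = s • e := by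
  by_cases hL : ∃ y ∈ L, y ≠ x
  · obtain ⟨y, hy, hyx⟩ := hL
    have hne : y - x ≠ 0 := sub_ne_zero.2 hyx
    have hpos : 0 < ‖y - x‖ := norm_pos_iff.2 hne
    obtain ⟨j, hj⟩ : ∃ j, y j - x j ≠ 0 := by
      by_contra! hcon
      exact hne (PiLp.ext fun j => by simpa using hcon j)
    refine ⟨‖y - x‖⁻¹ • (y - x), by rw [norm_smul, norm_inv, norm_norm, inv_mul_cancel₀ hpos.ne'],
      fun z hz => ⟨(z j - x j) / (y j - x j) * ‖y - x‖, ?_⟩⟩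
    rw [smul_smul, mul_assoc, mul_inv_cancel₀ hpos.ne', mul_one]
    ext k
    simp only [PiLp.sub_apply, PiLp.smul_apply, smul_eq_mul]
    rcases eq_or_ne j k with rfl | hjk
    · field_simp
    · have := minor_eq_zero_of_halfSpaces (h j k hjk) hx hy hz
      field_simp
      linarith
  · push Not at hL
    refine ⟨EuclideanSpace.single ⟨0, hn⟩ 1, by simp, fun z hz => ⟨0, ?_⟩⟩
    simp [hL z hz]

/-- Localization: a compact convex body can be shrunk to a compact convex body arbitrarily close to
a segment, keeping the equality `∫ G = 0` and the strict inequality `∫ F < 0`. -/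
theorem exists_needle {n : ℕ} (hn : 0 < n) {G F : EuclideanSpace ℝ (Fin n) → ℝ}
    {K₀ : Set (EuclideanSpace ℝ (Fin n))} (hK₀ : IsCompact K₀) (hK₀c : Convex ℝ K₀)
    (hG : IntegrableOn G K₀) (hF : IntegrableOn F K₀)
    (hG0 : ∫ x in K₀, G x = 0) (hF0 : ∫ x in K₀, F x < 0) {ε : ℝ} (hε : 0 < ε) :
    ∃ K ⊆ K₀, IsCompact K ∧ Convex ℝ K ∧ ∫ x in K, G x = 0 ∧ ∫ x in K, F x < 0 ∧
      ∃ x₀ ∈ K, ∃ e : EuclideanSpace ℝ (Fin n), ‖e‖ = 1 ∧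
        ∀ x ∈ K, ‖(x - x₀) - inner ℝ e (x - x₀) • e‖ < ε := by
  classical
  let P : Set (EuclideanSpace ℝ (Fin n)) → Prop := fun K =>
    K ⊆ K₀ ∧ IsCompact K ∧ Convex ℝ K ∧ ∫ x in K, G x = 0 ∧ ∫ x in K, F x < 0
  have step : ∀ (i : Fin n × Fin n × ℚ × ℚ) (K : {K // P K}), ∃ K' : {K // P K}, K'.1 ⊆ K.1 ∧
      (i.1 ≠ i.2.1 → ∃ θ, K'.1 ⊆ coordHalfSpace i.1 i.2.1 i.2.2.1 i.2.2.2 θ) := by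
    rintro ⟨j, k, a, b⟩ ⟨K, hKs, hKk, hKc, hKG, hKF⟩
    rcases eq_or_ne j k with rfl | hjk
    · exact ⟨⟨K, hKs, hKk, hKc, hKG, hKF⟩, subset_rfl, fun h => absurd rfl h⟩
    · obtain ⟨θ, h1, h2⟩ := exists_coordHalfSpace_split hjk a b (hG.mono_set hKs)
        (hF.mono_set hKs) hKG hKF
      exact ⟨⟨K ∩ coordHalfSpace j k a b θ, Set.inter_subset_left.trans hKs,
        hKk.inter_right (isClosed_coordHalfSpace j k a b θ),
        hKc.inter (convex_coordHalfSpace j k a b θ), h1, h2⟩, Set.inter_subset_left,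
        fun _ => ⟨θ, Set.inter_subset_right⟩⟩
  choose next hnext hnext' using step
  have : Nonempty (Fin n × Fin n × ℚ × ℚ) := ⟨⟨⟨0, hn⟩, ⟨0, hn⟩, 0, 0⟩⟩
  obtain ⟨enum, henum⟩ := exists_surjective_nat (Fin n × Fin n × ℚ × ℚ)
  let Ks : ℕ → {K // P K} := fun m =>
    Nat.rec ⟨K₀, subset_rfl, hK₀, hK₀c, hG0, hF0⟩ (fun i K => next (enum i) K) m
  have hanti : Antitone fun m => (Ks m).1 := antitone_nat_of_succ_le fun m => hnext _ _
  have hnonempty : ∀ m, (Ks m).1.Nonempty := by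
    intro m
    by_contra h
    have := (Ks m).2.2.2.2.2
    rw [Set.not_nonempty_iff_eq_empty.1 h] at this
    simp at this
  obtain ⟨x₀, hx₀⟩ := IsCompact.nonempty_iInter_of_sequence_nonempty_isCompact_isClosed
    (fun m => (Ks m).1) (fun m => hnext _ _) hnonempty (Ks 0).2.2.1
    fun m => (Ks m).2.2.1.isClosed
  set L := ⋂ m, (Ks m).1 with hL
  have hhalf : ∀ j k, j ≠ k → ∀ a b : ℚ, ∃ θ, L ⊆ coordHalfSpace j k a b θ := by
    intro j k hjk a b
    obtain ⟨m, hm⟩ := henum (j, k, a, b)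
    obtain ⟨θ, hθ⟩ := hnext' (enum m) (Ks m) (by rw [hm]; exact hjk)
    rw [hm] at hθ
    refine ⟨θ, subset_trans ?_ hθ⟩
    rw [← hm]
    exact Set.iInter_subset (fun m => (Ks m).1) (m + 1)
  obtain ⟨e, he, hline⟩ := exists_unit_of_halfSpaces hn hhalf hx₀
  have hopen : IsOpen {x | ‖(x - x₀) - inner ℝ e (x - x₀) • e‖ < ε} :=
    isOpen_lt (by fun_prop) continuous_const
  have hLsub : L ⊆ {x | ‖(x - x₀) - inner ℝ e (x - x₀) • e‖ < ε} := by
    intro z hz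
    obtain ⟨s, hs⟩ := hline z hz
    simp [hs, inner_smul_right, he, hε]
  obtain ⟨m, hm⟩ := exists_subset_nhds_of_isCompact (V := fun m => (Ks m).1)
    hanti.directed_ge (fun m => (Ks m).2.2.1)
    (fun x hx => hopen.mem_nhds (hLsub hx))
  exact ⟨(Ks m).1, (Ks m).2.1, (Ks m).2.2.1, (Ks m).2.2.2.1, (Ks m).2.2.2.2.1, (Ks m).2.2.2.2.2,
    x₀, Set.iInter_subset (fun m => (Ks m).1) m hx₀, e, he, hm⟩

lemma integrable_continuous_mul {E : Type*} [NormedAddCommGroup E] [MeasurableSpace E]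
    [BorelSpace E] {μ : Measure E} [IsFiniteMeasureOnCompacts μ] {g W : E → ℝ} {M : ℝ} {K : Set E}
    (hg : Continuous g) (hWm : Measurable W) (hW0 : ∀ x, 0 ≤ W x) (hWM : ∀ x, W x ≤ M)
    (hWK : ∀ x, W x ≠ 0 → x ∈ K) (hK : IsCompact K) : Integrable (fun x => g x * W x) μ := by
  have h1 : IntegrableOn g K μ := hg.continuousOn.integrableOn_compact hK
  have h2 : IntegrableOn (fun x => g x * W x) K μ :=
    h1.mul_bdd hWm.aestronglyMeasurable (Filter.Eventually.of_forall fun x => by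
      rw [norm_eq_abs, abs_of_nonneg (hW0 x)]; exact hWM x)
  refine (integrableOn_iff_integrable_of_support_subset fun x hx => hWK x fun h => hx ?_).1 h2
  simp [h]

/-- The marginal of a bounded, compactly supported log-concave function along a unit direction. -/
lemma exists_marginal {n : ℕ} (hn : 0 < n) {W : EuclideanSpace ℝ (Fin n) → ℝ} {M R : ℝ}
    (hWlc : MulLogConcave W) (hWm : Measurable W) (hW0 : ∀ x, 0 ≤ W x) (hWM : ∀ x, W x ≤ M)
    (x₁ e : EuclideanSpace ℝ (Fin n)) (he : ‖e‖ = 1)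
    (hWR : ∀ x, W x ≠ 0 → ‖x - x₁‖ ≤ R) :
    ∃ w : ℝ → ℝ, ∃ M' : ℝ, Measurable w ∧ MulLogConcave w ∧ (∀ r, 0 ≤ w r) ∧ (∀ r, w r ≤ M') ∧
      (∀ r, w r ≠ 0 → ∃ x, W x ≠ 0 ∧ inner ℝ e (x - x₁) = r) ∧
      ∀ f : ℝ → ℝ, Continuous f → ∫ x, f (inner ℝ e (x - x₁)) * W x = ∫ r, f r * w r := by
  obtain ⟨k, rfl⟩ := Nat.exists_eq_succ_of_ne_zero hn.ne'
  obtain ⟨b, hb⟩ := Orthonormal.exists_orthonormalBasis_extension_of_card_eq (𝕜 := ℝ)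
    (E := EuclideanSpace ℝ (Fin (k + 1))) (ι := Fin (k + 1)) (by simp) (v := fun _ => e)
    (s := {0}) ⟨fun _ => he, fun i j hij => absurd (Subsingleton.elim i j) hij⟩
  have hb0 : b 0 = e := hb 0 rfl
  set T : ℝ × (Fin k → ℝ) → EuclideanSpace ℝ (Fin (k + 1)) := fun z =>
    b.repr.symm (WithLp.toLp 2 (Fin.cons z.1 z.2 : Fin (k + 1) → ℝ)) + x₁ with hT
  have hinner : ∀ z, inner ℝ e (T z - x₁) = z.1 := by
    intro z
    rw [hT, add_sub_cancel_right, ← hb0, ← b.repr_apply_apply]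
    simp
  have hcoord : ∀ z i, |z.2 i| ≤ ‖T z - x₁‖ := by
    intro z i
    rw [hT, add_sub_cancel_right, LinearIsometryEquiv.norm_map]
    have := PiLp.norm_apply_le (p := 2) (WithLp.toLp 2 (Fin.cons z.1 z.2 : Fin (k + 1) → ℝ)) i.succ
    simpa using this
  have hTaff : ∀ x y : ℝ × (Fin k → ℝ), ∀ s t : ℝ, s + t = 1 →
      T (s • x + t • y) = s • T x + t • T y := by
    intro x y s t hst
    have hc : WithLp.toLp 2 (Fin.cons (s • x + t • y).1 (s • x + t • y).2 : Fin (k + 1) → ℝ)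
        = s • WithLp.toLp 2 (Fin.cons x.1 x.2 : Fin (k + 1) → ℝ)
          + t • WithLp.toLp 2 (Fin.cons y.1 y.2 : Fin (k + 1) → ℝ) := by
      ext i
      refine Fin.cases ?_ (fun j => ?_) i <;> simp
    simp only [hT]
    rw [hc, map_add, map_smul, map_smul]
    nth_rewrite 1 [show x₁ = (s + t) • x₁ by rw [hst, one_smul]]
    module
  let Te : ℝ × (Fin k → ℝ) ≃ᵐ EuclideanSpace ℝ (Fin (k + 1)) :=
    ((MeasurableEquiv.piFinSuccAbove (fun _ : Fin (k + 1) => ℝ) 0).symm.trans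
      ((MeasurableEquiv.toLp 2 (Fin (k + 1) → ℝ)).trans
        b.repr.symm.toHomeomorph.toMeasurableEquiv)).trans (MeasurableEquiv.addRight x₁)
  have hTe : ∀ z, Te z = T z := by
    intro z
    simp [Te, hT, MeasurableEquiv.piFinSuccAbove, Fin.insertNthEquiv]
  have hmp : MeasurePreserving Te := by
    have h1 := (volume_preserving_piFinSuccAbove (fun _ : Fin (k + 1) => ℝ) 0).symm
    have h2 := PiLp.volume_preserving_toLp (Fin (k + 1))
    have h3 := b.measurePreserving_repr_symm
    have h4 := measurePreserving_add_right
      (volume : Measure (EuclideanSpace ℝ (Fin (k + 1)))) x₁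
    exact h4.comp (h3.comp (h2.comp h1))
  have hTm : Measurable T := by
    rw [← funext hTe]; exact Te.measurable
  set F : ℝ × (Fin k → ℝ) → ℝ := fun z => W (T z) with hF
  have hFlc : MulLogConcave F := hWlc.comp_affine T hTaff
  have hFR : ∀ r y, F (r, y) ≠ 0 → ∀ i, |y i| ≤ R := fun r y h i =>
    (hcoord (r, y) i).trans (hWR _ h)
  have hFm : ∀ r, Measurable fun y => F (r, y) := fun r =>
    (hWm.comp hTm).comp measurable_prodMk_left
  have hw := MulLogConcave.integral_pi k hFlc (fun _ => hW0 _) (fun _ => hWM _) hFR hFm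
  refine ⟨fun r => ∫ y, F (r, y), M * volume.real (Set.Icc (fun _ : Fin k => -R) fun _ => R),
    hw.measurable fun r => integral_nonneg fun _ => hW0 _, hw,
    fun r => integral_nonneg fun _ => hW0 _,
    fun r => (integrable_of_bounded_box (hFm r) (fun _ => hW0 _) (fun _ => hWM _) (hFR r)).2,
    fun r hr => ?_, fun f hf => ?_⟩
  · have : ∃ y, F (r, y) ≠ 0 := by
      by_contra! h
      exact hr (by simp [h])
    obtain ⟨y, hy⟩ := this
    exact ⟨T (r, y), hy, hinner _⟩
  · have hint := integrable_continuous_mul (μ := volume) (K := Metric.closedBall x₁ R)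
      (g := fun x => f (inner ℝ e (x - x₁))) (by fun_prop) hWm hW0 hWM
      (fun x hx => by rw [Metric.mem_closedBall, dist_eq_norm]; exact hWR x hx)
      (isCompact_closedBall _ _)
    have hfF : ∀ z, f (inner ℝ e (Te z - x₁)) * W (Te z) = f z.1 * F z := fun z => by
      rw [hTe, hinner]
    have hint' : Integrable fun z : ℝ × (Fin k → ℝ) => f z.1 * F z := by
      have := (hmp.integrable_comp_emb Te.measurableEmbedding).2 hint
      exact this.congr (Filter.Eventually.of_forall hfF)
    rw [← hmp.integral_comp Te.measurableEmbedding]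
    simp_rw [hfF]
    rw [Measure.volume_eq_prod, integral_prod _ hint']
    exact integral_congr_ae (Filter.Eventually.of_forall fun r =>
      integral_const_mul (f r) fun y => F (r, y))

/-- The one-dimensional Poincaré inequality, for functions depending on a single direction. -/
lemma exists_integral_rayleigh_inner_nonneg {n : ℕ} (hn : 0 < n) {p μ B D M : ℝ} (hp : 1 < p)
    (hμ : 0 < μ) (hB : 0 < B)
    (hD : D / 2 ≤ ∫ r in (0 : ℝ)..B, 1 / (μ + (p - 1) * r ^ (p / (p - 1))))
    {W : EuclideanSpace ℝ (Fin n) → ℝ} (hWlc : MulLogConcave W) (hWm : Measurable W)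
    (hW0 : ∀ x, 0 ≤ W x) (hWM : ∀ x, W x ≤ M) {K : Set (EuclideanSpace ℝ (Fin n))}
    (hWK : ∀ x, W x ≠ 0 → x ∈ K) (hKD : ∀ x ∈ K, ∀ y ∈ K, ‖x - y‖ ≤ D)
    {x₀ e : EuclideanSpace ℝ (Fin n)} (hx₀ : x₀ ∈ K) (he : ‖e‖ = 1)
    {v v' : ℝ → ℝ} (hv : ∀ s, HasDerivAt v (v' s) s) (hv' : Continuous v') :
    ∃ c, |c| ≤ D ∧ 0 ≤ ∫ x, (|v' (inner ℝ e (x - x₀))| ^ p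
      - μ * |v (inner ℝ e (x - x₀)) - v c| ^ p) * W x := by
  have hD0 : 0 ≤ D := by simpa using hKD x₀ hx₀ x₀ hx₀
  set S := (fun x => inner ℝ e (x - x₀)) '' K with hS
  have h0S : (0 : ℝ) ∈ S := ⟨x₀, hx₀, by simp⟩
  have hinner : ∀ x ∈ K, ∀ y ∈ K, |inner ℝ e (x - x₀) - inner ℝ e (y - x₀)| ≤ D := by
    intro x hx y hy
    rw [← inner_sub_right, sub_sub_sub_cancel_right]
    have := abs_real_inner_le_norm e (x - y)
    rw [he, one_mul] at this
    exact this.trans (hKD x hx y hy)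
  have hbdd : BddBelow S := ⟨-D, by
    rintro _ ⟨x, hx, rfl⟩
    have := hinner x hx x₀ hx₀
    simp only [sub_self, inner_zero_right, sub_zero] at this
    exact (abs_le.1 this).1⟩
  set m := sInf S + D / 2 with hm
  have hle : sInf S ≤ 0 := csInf_le hbdd h0S
  have hge : -D ≤ sInf S := le_csInf ⟨0, h0S⟩ (by
    rintro _ ⟨x, hx, rfl⟩
    have := hinner x hx x₀ hx₀
    simp only [sub_self, inner_zero_right, sub_zero] at this
    exact (abs_le.1 this).1)
  have hmS : ∀ x ∈ K, |inner ℝ e (x - x₀) - m| ≤ D / 2 := by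
    intro x hx
    have h1 : sInf S ≤ inner ℝ e (x - x₀) := csInf_le hbdd ⟨x, hx, rfl⟩
    have h2 : inner ℝ e (x - x₀) - D ≤ sInf S := le_csInf ⟨0, h0S⟩ (by
      rintro _ ⟨y, hy, rfl⟩
      have := (abs_le.1 (hinner x hx y hy)).2
      simp only
      linarith)
    rw [abs_le]; constructor <;> linarith
  have hin : ∀ x, inner ℝ e (x - (x₀ + m • e)) = inner ℝ e (x - x₀) - m := by
    intro x
    rw [← sub_sub, inner_sub_right, inner_smul_right, real_inner_self_eq_norm_sq, he]
    ring
  obtain ⟨w, M', hwm, hwlc, hw0, hwM, hwsupp, hwint⟩ := exists_marginal hn (R := D + D) hWlc hWm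
    hW0 hWM (x₀ + m • e) e he (fun x hx => by
      have h1 := hKD x (hWK x hx) x₀ hx₀
      have h2 : ‖m • e‖ ≤ D := by
        rw [norm_smul, he, mul_one, norm_eq_abs, abs_le]; constructor <;> linarith
      rw [← sub_sub]
      exact (norm_sub_le _ _).trans (add_le_add h1 h2))
  obtain ⟨c, hc, hmain⟩ := exists_integral_rayleigh_nonneg (v := fun s => v (s + m))
    (v' := fun s => v' (s + m)) hp hμ hB (by linarith : 0 ≤ D / 2) hD
    (fun x => (hv (x + m)).comp_add_const x m) (by fun_prop) hwm hw0 hwM hwlc (fun r hr => by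
      by_contra h
      obtain ⟨x, hx, hxr⟩ := hwsupp r h
      rw [hin] at hxr
      have := hmS x (hWK x hx)
      rw [hxr] at this
      exact absurd hr (not_lt.2 this))
  have hvc : Continuous v := continuous_iff_continuousAt.2 fun s => (hv s).continuousAt
  have hp0 : 0 ≤ p := by linarith
  refine ⟨c + m, ?_, ?_⟩
  · have := hc.1
    have := hc.2
    rw [abs_le]; constructor <;> linarith
  · rw [← hwint (fun s => |v' (s + m)| ^ p - μ * |v (s + m) - v (c + m)| ^ p) (by
      fun_prop (disch := exact Or.inr hp0))] at hmain
    simpa only [hin, sub_add_cancel] using hmain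

lemma MulLogConcave.indicator {E : Type*} [AddCommGroup E] [Module ℝ E] {W : E → ℝ}
    (hW : MulLogConcave W) (hW0 : ∀ x, 0 ≤ W x) {K : Set E} (hK : Convex ℝ K) :
    MulLogConcave (K.indicator W) := by
  intro x y s t hs ht hst
  by_cases hx : x ∈ K
  · by_cases hy : y ∈ K
    · rw [Set.indicator_of_mem hx, Set.indicator_of_mem hy,
        Set.indicator_of_mem (hK hx hy hs.le ht.le hst)]
      exact hW x y s t hs ht hst
    · rw [Set.indicator_of_notMem hy, zero_rpow ht.ne', mul_zero]
      exact Set.indicator_nonneg (fun _ _ => hW0 _) _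
  · rw [Set.indicator_of_notMem hx, zero_rpow hs.ne', zero_mul]
    exact Set.indicator_nonneg (fun _ _ => hW0 _) _

lemma continuous_deriv_abs_rpow {p : ℝ} (hp : 1 < p) :
    Continuous (deriv fun a : ℝ => |a| ^ p) := by
  have : ContDiff ℝ 1 fun a : ℝ => |a| ^ p := contDiff_norm_rpow hp
  exact this.continuous_deriv le_rfl

lemma deriv_abs_rpow {p : ℝ} (hp : 1 < p) (a : ℝ) :
    deriv (fun a : ℝ => |a| ^ p) a = p * |a| ^ (p - 2) * a :=
  (hasDerivAt_abs_rpow a hp).deriv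

lemma abs_rpow_add_deriv_mul_le {p : ℝ} (hp : 1 < p) (a b : ℝ) :
    |a| ^ p + deriv (fun a : ℝ => |a| ^ p) a * (b - a) ≤ |b| ^ p := by
  have hconv : ConvexOn ℝ Set.univ fun a : ℝ => |a| ^ p := by
    have h1 : ConvexOn ℝ Set.univ fun a : ℝ => |a| := convexOn_univ_norm
    have h2 : ConvexOn ℝ ((fun a : ℝ => |a|) '' Set.univ) fun r : ℝ => r ^ p :=
      (convexOn_rpow hp.le).subset (by rintro _ ⟨x, -, rfl⟩; exact abs_nonneg x) (by
        have : (fun a : ℝ => |a|) '' Set.univ = Set.Ici 0 := by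
          ext r
          exact ⟨by rintro ⟨x, -, rfl⟩; exact abs_nonneg x,
            fun hr => ⟨r, Set.mem_univ r, abs_of_nonneg hr⟩⟩
        rw [this]
        exact convex_Ici 0)
    refine h2.comp h1 ?_
    rintro _ ⟨x, -, rfl⟩ _ ⟨y, -, rfl⟩ hxy
    exact rpow_le_rpow (abs_nonneg x) hxy (by linarith)
  have hd := (hasDerivAt_abs_rpow a hp)
  rw [hd.deriv]
  rcases lt_trichotomy a b with h | h | h
  · have := hconv.le_slope_of_hasDerivAt (Set.mem_univ a) (Set.mem_univ b) h hd
    rw [slope_def_field, le_div_iff₀ (by linarith)] at this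
    linarith
  · simp [h]
  · have := hconv.slope_le_of_hasDerivAt (Set.mem_univ b) (Set.mem_univ a) h hd
    rw [slope_def_field, div_le_iff₀ (by linarith)] at this
    linarith

lemma rayleigh_le_of_contDiff_of_integral_eq_zero {n : ℕ} (hn : 0 < n) {p μ B D M : ℝ} (hp : 1 < p)
    (hμ : 0 < μ) (hB : 0 < B)
    (hD : D / 2 ≤ ∫ r in (0 : ℝ)..B, 1 / (μ + (p - 1) * r ^ (p / (p - 1))))
    {W : EuclideanSpace ℝ (Fin n) → ℝ} (hWlc : MulLogConcave W) (hWm : Measurable W)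
    (hW0 : ∀ x, 0 ≤ W x) (hWM : ∀ x, W x ≤ M) {K₀ : Set (EuclideanSpace ℝ (Fin n))}
    (hK₀ : IsCompact K₀) (hK₀c : Convex ℝ K₀) (hK₀ne : K₀.Nonempty)
    (hWK : ∀ x, W x ≠ 0 → x ∈ K₀) (hKD : ∀ x ∈ K₀, ∀ y ∈ K₀, ‖x - y‖ ≤ D)
    {u : EuclideanSpace ℝ (Fin n) → ℝ} (hu : ContDiff ℝ 1 u)
    (hmean : ∫ x, deriv (fun a : ℝ => |a| ^ p) (u x) * W x = 0) :
    μ * ∫ x, |u x| ^ p * W x ≤ ∫ x, ‖fderiv ℝ u x‖ ^ p * W x := by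
  obtain ⟨z, hz⟩ := hK₀ne
  have hD0 : 0 ≤ D := by simpa using hKD z hz z hz
  have hp0 : 0 ≤ p := by linarith
  have huc := hu.continuous
  have hu' : Continuous (fderiv ℝ u) := hu.continuous_fderiv one_ne_zero
  have hφ := continuous_deriv_abs_rpow hp
  set φ := deriv fun a : ℝ => |a| ^ p with hφdef
  by_contra! hlt
  have hint : ∀ {g : EuclideanSpace ℝ (Fin n) → ℝ}, Continuous g →
      Integrable fun x => g x * W x := fun hg =>
    integrable_continuous_mul hg hWm hW0 hWM hWK hK₀
  have hc1 : Continuous fun x => ‖fderiv ℝ u x‖ ^ p := by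
    fun_prop (disch := exact fun _ => Or.inr hp0)
  have hc2 : Continuous fun x => |u x| ^ p := by
    fun_prop (disch := exact fun _ => Or.inr hp0)
  obtain ⟨δ, hδ, hFneg⟩ : ∃ δ > 0,
      ∫ x, (‖fderiv ℝ u x‖ ^ p - μ * |u x| ^ p + δ) * W x < 0 := by
    have hm : 0 ≤ ∫ x, W x := integral_nonneg hW0
    set I := μ * ∫ x, |u x| ^ p * W x with hI
    set J := ∫ x, ‖fderiv ℝ u x‖ ^ p * W x with hJ
    refine ⟨(I - J) / (2 * (1 + ∫ x, W x)), div_pos (by linarith) (by linarith), ?_⟩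
    set δ := (I - J) / (2 * (1 + ∫ x, W x)) with hδ
    have hδ0 : 0 < δ := div_pos (by linarith) (by linarith)
    have : ∫ x, (‖fderiv ℝ u x‖ ^ p - μ * |u x| ^ p + δ) * W x = J - I + δ * ∫ x, W x := by
      have h1 := integral_add (hint (hc1.sub (hc2.const_mul μ))) (hint (continuous_const (y := δ)))
      have h2 := integral_sub (hint hc1) ((hint hc2).const_mul μ)
      rw [integral_const_mul] at h1 h2
      rw [hJ, hI, ← h2, ← integral_const_mul]
      simp only [Pi.sub_apply] at h1
      rw [integral_const_mul, show (fun x => ‖fderiv ℝ u x‖ ^ p * W x - μ * (|u x| ^ p * W x))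
        = fun x => (‖fderiv ℝ u x‖ ^ p - μ * |u x| ^ p) * W x by ext; ring, ← h1]
      simp only [add_mul]
    rw [this]
    have h2 : δ * (2 * (1 + ∫ x, W x)) = I - J := div_mul_cancel₀ _ (by linarith)
    nlinarith
  set Bb := Metric.closedBall z (2 * D) with hBb
  have hBc : IsCompact Bb := isCompact_closedBall _ _
  obtain ⟨C, hC⟩ := hBc.exists_bound_of_continuousOn huc.continuousOn
  obtain ⟨ε₁, hε₁, h₁⟩ := Metric.uniformContinuousOn_iff_le.1
    (hBc.uniformContinuousOn_of_continuous hc1.continuousOn) (δ / 2) (by linarith)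
  have hc3 : Continuous fun q : EuclideanSpace ℝ (Fin n) × ℝ => |u q.1 - q.2| ^ p := by
    fun_prop (disch := exact fun _ => Or.inr hp0)
  obtain ⟨ε₂, hε₂, h₂⟩ := Metric.uniformContinuousOn_iff_le.1
    ((hBc.prod (isCompact_Icc (a := -C) (b := C))).uniformContinuousOn_of_continuous
      hc3.continuousOn) (δ / (2 * μ)) (by positivity)
  have hWK₀ : ∀ g : EuclideanSpace ℝ (Fin n) → ℝ, ∫ x in K₀, g x * W x = ∫ x, g x * W x := fun g =>
    setIntegral_eq_integral_of_forall_compl_eq_zero fun x hx => by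
      rw [not_not.1 fun h => hx (hWK x h), mul_zero]
  have hcF : Continuous fun x => ‖fderiv ℝ u x‖ ^ p - μ * |u x| ^ p + δ := by fun_prop
  obtain ⟨K, hKs, hKk, hKc, hKG, hKF, x₀, hx₀, e, he, hnear⟩ := exists_needle hn hK₀ hK₀c
    (hint (hφ.comp huc)).integrableOn (hint hcF).integrableOn ((hWK₀ _).trans hmean)
    ((hWK₀ _).trans_lt hFneg) (lt_min hε₁ hε₂)
  have hWKm : Measurable (K.indicator W) := hWm.indicator hKk.isClosed.measurableSet
  have hWK0 : ∀ x, 0 ≤ K.indicator W x := fun x => Set.indicator_nonneg (fun _ _ => hW0 _) _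
  have hWKM : ∀ x, K.indicator W x ≤ M := fun x =>
    (Set.indicator_le_self' (fun _ _ => hW0 _) x).trans (hWM x)
  have hWKs : ∀ x, K.indicator W x ≠ 0 → x ∈ K := fun x hx => Set.mem_of_indicator_ne_zero hx
  have hintK : ∀ {g : EuclideanSpace ℝ (Fin n) → ℝ}, Continuous g →
      Integrable fun x => g x * K.indicator W x := fun hg =>
    integrable_continuous_mul hg hWKm hWK0 hWKM hWKs hKk
  have hsetK : ∀ g : EuclideanSpace ℝ (Fin n) → ℝ,
      ∫ x in K, g x * W x = ∫ x, g x * K.indicator W x := fun g => by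
    rw [← integral_indicator hKk.isClosed.measurableSet]
    simp_rw [Set.indicator_mul_right]
  have hvd : ∀ s, HasDerivAt (fun s : ℝ => u (x₀ + s • e)) (fderiv ℝ u (x₀ + s • e) e) s := by
    intro s
    have h1 : HasDerivAt (fun s : ℝ => x₀ + s • e) e s := by
      simpa using ((hasDerivAt_id s).smul_const e).const_add x₀
    exact ((hu.differentiable one_ne_zero).differentiableAt.hasFDerivAt).comp_hasDerivAt s h1
  obtain ⟨c, hcD, hmain⟩ := exists_integral_rayleigh_inner_nonneg hn hp hμ hB hD
    (hWlc.indicator hW0 hKc) hWKm hWK0 hWKM hWKs (fun x hx y hy => hKD x (hKs hx) y (hKs hy))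
    hx₀ he hvd (by fun_prop)
  set τ := u (x₀ + c • e) with hτ
  have hline : ∀ s : ℝ, |s| ≤ D → x₀ + s • e ∈ Bb := by
    intro s hs
    rw [hBb, Metric.mem_closedBall, dist_eq_norm, add_sub_right_comm]
    refine (norm_add_le _ _).trans ?_
    rw [norm_smul, he, mul_one, norm_eq_abs]
    linarith [hKD x₀ (hKs hx₀) z hz]
  have hKBb : ∀ x ∈ K, x ∈ Bb := fun x hx => by
    rw [hBb, Metric.mem_closedBall, dist_eq_norm]
    linarith [hKD x (hKs hx) z hz]
  have hτC : τ ∈ Set.Icc (-C) C := abs_le.1 (hC _ (hline c hcD))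
  have hpt : ∀ x, (|fderiv ℝ u (x₀ + inner ℝ e (x - x₀) • e) e| ^ p
      - μ * |u (x₀ + inner ℝ e (x - x₀) • e) - τ| ^ p) * K.indicator W x
      ≤ (‖fderiv ℝ u x‖ ^ p - μ * |u x| ^ p + δ) * K.indicator W x
        + (μ * τ) * (φ (u x) * K.indicator W x) := by
    intro x
    by_cases hx : x ∈ K
    swap
    · simp [hx]
    set s := inner ℝ e (x - x₀) with hs
    have hsD : |s| ≤ D := by
      have := abs_real_inner_le_norm e (x - x₀)
      rw [he, one_mul] at this
      exact this.trans (hKD x (hKs hx) x₀ (hKs hx₀))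
    have hyB := hline s hsD
    have hdist : dist (x₀ + s • e) x ≤ min ε₁ ε₂ := by
      rw [dist_comm, dist_eq_norm, ← sub_sub]
      exact (hnear x hx).le
    have e1 : |fderiv ℝ u (x₀ + s • e) e| ^ p ≤ ‖fderiv ℝ u x‖ ^ p + δ / 2 := by
      have h := h₁ _ hyB x (hKBb x hx) (hdist.trans (min_le_left _ _))
      rw [Real.dist_eq] at h
      have h3 : |fderiv ℝ u (x₀ + s • e) e| ≤ ‖fderiv ℝ u (x₀ + s • e)‖ := by
        have := (fderiv ℝ u (x₀ + s • e)).le_opNorm e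
        rwa [he, mul_one] at this
      have h4 := rpow_le_rpow (abs_nonneg _) h3 hp0
      linarith [(abs_le.1 h).2]
    have e2 : |u x - τ| ^ p ≤ |u (x₀ + s • e) - τ| ^ p + δ / (2 * μ) := by
      have h := h₂ (x₀ + s • e, τ) ⟨hyB, hτC⟩ (x, τ) ⟨hKBb x hx, hτC⟩ (by
        rw [Prod.dist_eq, dist_self, max_eq_left dist_nonneg]
        exact hdist.trans (min_le_right _ _))
      rw [Real.dist_eq] at h
      linarith [(abs_le.1 h).1]
    have e3 := abs_rpow_add_deriv_mul_le hp (u x) (u x - τ)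
    rw [← hφdef] at e3
    have e4 : μ * (|u x| ^ p - φ (u x) * τ) ≤ μ * (|u (x₀ + s • e) - τ| ^ p + δ / (2 * μ)) :=
      mul_le_mul_of_nonneg_left (by linarith) hμ.le
    have e5 : μ * (δ / (2 * μ)) = δ / 2 := by field_simp
    have := mul_le_mul_of_nonneg_right (show |fderiv ℝ u (x₀ + s • e) e| ^ p
      - μ * |u (x₀ + s • e) - τ| ^ p ≤ ‖fderiv ℝ u x‖ ^ p - μ * |u x| ^ p + δ
        + μ * τ * φ (u x) by linarith) (hWK0 x)
    linarith
  have hle := integral_mono (hintK (by fun_prop (disch := exact fun _ => Or.inr hp0)))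
    ((hintK hcF).add ((hintK (hφ.comp huc)).const_mul (μ * τ))) hpt
  have hsum : ∫ x, ((‖fderiv ℝ u x‖ ^ p - μ * |u x| ^ p + δ) * K.indicator W x
        + (μ * τ) * (φ (u x) * K.indicator W x))
      = (∫ x in K, (‖fderiv ℝ u x‖ ^ p - μ * |u x| ^ p + δ) * W x)
        + μ * τ * ∫ x in K, φ (u x) * W x := by
    rw [hsetK, hsetK, ← integral_const_mul]
    exact integral_add (hintK hcF) ((hintK (hφ.comp huc)).const_mul (μ * τ))
  simp only [Pi.add_apply, Function.comp_apply] at hle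
  rw [hsum] at hle
  simp only [Function.comp_apply] at hKG
  rw [hKG, mul_zero, add_zero] at hle
  linarith

lemma exists_integral_deriv_abs_rpow_sub_eq_zero {n : ℕ} {p M C : ℝ} (hp : 1 < p)
    {W : EuclideanSpace ℝ (Fin n) → ℝ} (hWm : Measurable W)
    (hW0 : ∀ x, 0 ≤ W x) (hWM : ∀ x, W x ≤ M) {K₀ : Set (EuclideanSpace ℝ (Fin n))}
    (hK₀ : IsCompact K₀) (hC0 : 0 ≤ C) (hWK : ∀ x, W x ≠ 0 → x ∈ K₀)
    {u : EuclideanSpace ℝ (Fin n) → ℝ} (hu : Continuous u) (hC : ∀ x ∈ K₀, |u x| ≤ C) :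
    ∃ t ∈ Set.Icc (-C) C, ∫ x, deriv (fun a : ℝ => |a| ^ p) (u x - t) * W x = 0 := by
  have hφ := continuous_deriv_abs_rpow hp
  have hpos : ∀ a : ℝ, 0 ≤ a → 0 ≤ deriv (fun a : ℝ => |a| ^ p) a := fun a ha => by
    rw [deriv_abs_rpow hp]
    exact mul_nonneg (mul_nonneg (by linarith) (rpow_nonneg (abs_nonneg _) _)) ha
  have hneg : ∀ a : ℝ, a ≤ 0 → deriv (fun a : ℝ => |a| ^ p) a ≤ 0 := fun a ha => by
    rw [deriv_abs_rpow hp]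
    exact mul_nonpos_of_nonneg_of_nonpos
      (mul_nonneg (by linarith) (rpow_nonneg (abs_nonneg _) _)) ha
  set φ := deriv fun a : ℝ => |a| ^ p
  obtain ⟨A, hA⟩ := (isCompact_Icc (a := -(2 * C)) (b := 2 * C)).exists_bound_of_continuousOn
    hφ.continuousOn
  have hcont : ContinuousOn (fun t => ∫ x, φ (u x - t) * W x) (Set.Icc (-C) C) := by
    refine continuousOn_of_dominated (bound := fun x => A * W x) ?_ ?_ ?_ ?_
    · intro t _
      exact ((hφ.comp (hu.sub continuous_const)).measurable.mul hWm).aestronglyMeasurable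
    · intro t ht
      refine Filter.Eventually.of_forall fun x => ?_
      by_cases hx : W x = 0
      · simp [hx]
      · rw [norm_mul, norm_eq_abs (W x), abs_of_nonneg (hW0 x)]
        refine mul_le_mul_of_nonneg_right (hA _ ?_) (hW0 x)
        have := abs_le.1 (hC x (hWK x hx))
        exact ⟨by linarith [ht.2], by linarith [ht.1]⟩
    · exact integrable_continuous_mul continuous_const hWm hW0 hWM hWK hK₀
    · exact Filter.Eventually.of_forall fun x => by fun_prop
  have hl : 0 ≤ ∫ x, φ (u x - -C) * W x := integral_nonneg fun x => by
    by_cases hx : W x = 0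
    · simp [hx]
    · exact mul_nonneg (hpos _ (by linarith [(abs_le.1 (hC x (hWK x hx))).1])) (hW0 x)
  have hr : ∫ x, φ (u x - C) * W x ≤ 0 := integral_nonpos fun x => by
    by_cases hx : W x = 0
    · simp [hx]
    · exact mul_nonpos_of_nonpos_of_nonneg
        (hneg _ (by linarith [(abs_le.1 (hC x (hWK x hx))).2])) (hW0 x)
  exact intermediate_value_Icc' (by linarith) hcont ⟨hr, hl⟩

theorem exists_rayleigh_le_of_contDiff {n : ℕ} (hn : 0 < n) {p μ D M C : ℝ} (hp : 1 < p)
    (hμ : 0 < μ) (hD : 0 < D) (hμD : μ < (piP p / D) ^ p)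
    {W : EuclideanSpace ℝ (Fin n) → ℝ} (hWlc : MulLogConcave W) (hWm : Measurable W)
    (hW0 : ∀ x, 0 ≤ W x) (hWM : ∀ x, W x ≤ M) {K₀ : Set (EuclideanSpace ℝ (Fin n))}
    (hK₀ : IsCompact K₀) (hK₀c : Convex ℝ K₀) (hK₀ne : K₀.Nonempty)
    (hWK : ∀ x, W x ≠ 0 → x ∈ K₀) (hKD : ∀ x ∈ K₀, ∀ y ∈ K₀, ‖x - y‖ ≤ D)
    {u : EuclideanSpace ℝ (Fin n) → ℝ} (hu : ContDiff ℝ 1 u) (hC : ∀ x ∈ K₀, |u x| ≤ C) :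
    ∃ t ∈ Set.Icc (-C) C,
      μ * ∫ x, |u x - t| ^ p * W x ≤ ∫ x, ‖fderiv ℝ u x‖ ^ p * W x := by
  obtain ⟨B, hB, hDB⟩ := exists_lt_integral_inv_add_mul_rpow hp hμ hD hμD
  have hC0 : 0 ≤ C := by
    obtain ⟨z, hz⟩ := hK₀ne
    exact (abs_nonneg _).trans (hC z hz)
  obtain ⟨t, ht, hmean⟩ := exists_integral_deriv_abs_rpow_sub_eq_zero hp hWm hW0 hWM hK₀ hC0 hWK
    hu.continuous hC
  refine ⟨t, ht, ?_⟩
  have := rayleigh_le_of_contDiff_of_integral_eq_zero hn hp hμ hB hDB.le hWlc hWm hW0 hWM hK₀ hK₀c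
    hK₀ne hWK hKD (hu.sub (contDiff_const (c := t))) hmean
  simpa only [fderiv_sub_const] using this

/-- Mollification of a Lipschitz function. -/
lemma exists_contDiff_approx {n : ℕ} {K : NNReal} {u : EuclideanSpace ℝ (Fin n) → ℝ}
    (hu : LipschitzWith K u) :
    ∃ v : ℕ → EuclideanSpace ℝ (Fin n) → ℝ, (∀ m, ContDiff ℝ 1 (v m)) ∧
      (∀ m x, |v m x - u x| ≤ K / (m + 1)) ∧ (∀ m x, ‖fderiv ℝ (v m) x‖ ≤ K) ∧
      ∀ᵐ x, Filter.Tendsto (fun m => fderiv ℝ (v m) x) Filter.atTop (nhds (fderiv ℝ u x)) := by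
  let φ : ℕ → ContDiffBump (0 : EuclideanSpace ℝ (Fin n)) := fun m =>
    ⟨1 / (2 * (m + 1)), 1 / (m + 1), by positivity, by
      apply one_div_lt_one_div_of_lt <;> linarith [Nat.cast_nonneg (α := ℝ) m]⟩
  have hD : Measurable (fderiv ℝ u) := measurable_fderiv ℝ u
  have hDK : ∀ x, ‖fderiv ℝ u x‖ ≤ K := fun x => norm_fderiv_le_of_lipschitz ℝ hu
  have hDloc : LocallyIntegrable (fderiv ℝ u) volume :=
    (memLp_top_of_bound hD.aestronglyMeasurable K
      (Filter.Eventually.of_forall hDK)).locallyIntegrable le_top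
  have hderiv : ∀ m x, HasFDerivAt
      (convolution ((φ m).normed volume) u (ContinuousLinearMap.lsmul ℝ ℝ) volume)
      (convolution ((φ m).normed volume) (fderiv ℝ u) (ContinuousLinearMap.lsmul ℝ ℝ) volume x)
      x := by
    intro m x
    have hρc : Continuous ((φ m).normed volume) := (φ m).continuous_normed
    have hρi : Integrable ((φ m).normed volume) volume := (φ m).integrable_normed
    refine (hasFDerivAt_integral_of_dominated_loc_of_lip (𝕜 := ℝ) (s := Set.univ)
      (bound := fun z => (φ m).normed volume z * K)
      (F := fun y z => (ContinuousLinearMap.lsmul ℝ ℝ) ((φ m).normed volume z) (u (y - z)))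
      (F' := fun z => (ContinuousLinearMap.lsmul ℝ ℝ) ((φ m).normed volume z)
        (fderiv ℝ u (x - z))) Filter.univ_mem ?_ ?_ ?_ ?_ ?_ ?_).2
    · refine Filter.Eventually.of_forall fun y => Continuous.aestronglyMeasurable ?_
      have := hu.continuous
      simp only [ContinuousLinearMap.lsmul_apply]
      fun_prop
    · refine Continuous.integrable_of_hasCompactSupport ?_ ?_
      · have := hu.continuous
        simp only [ContinuousLinearMap.lsmul_apply]
        fun_prop
      · exact (φ m).hasCompactSupport_normed.smul_right
    · simp only [ContinuousLinearMap.lsmul_apply]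
      exact (hρc.measurable.smul (hD.comp (measurable_const.sub measurable_id))).aestronglyMeasurable
    · refine Filter.Eventually.of_forall fun z => ?_
      refine LipschitzWith.lipschitzOnWith (LipschitzWith.of_dist_le_mul fun a b => ?_)
      have h0 : 0 ≤ (φ m).normed volume z := (φ m).nonneg_normed z
      simp only [ContinuousLinearMap.lsmul_apply, smul_eq_mul, Real.dist_eq]
      rw [← mul_sub, abs_mul, abs_of_nonneg h0, Real.coe_nnabs,
        abs_of_nonneg (mul_nonneg h0 K.coe_nonneg), mul_assoc]
      refine mul_le_mul_of_nonneg_left ?_ h0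
      have := hu.dist_le_mul (a - z) (b - z)
      rwa [Real.dist_eq, dist_sub_right] at this
    · exact hρi.mul_const _
    · have hae : ∀ᵐ z, DifferentiableAt ℝ u (x - z) :=
        (Measure.measurePreserving_sub_left volume x).quasiMeasurePreserving.ae
          hu.ae_differentiableAt
      filter_upwards [hae] with z hz
      have h1 := (hz.hasFDerivAt.comp x ((hasFDerivAt_id x).sub_const z)).const_smul
        ((φ m).normed volume z)
      exact h1
  have htend : Filter.Tendsto (fun m => (φ m).rOut) Filter.atTop (nhds 0) :=
    tendsto_one_div_add_atTop_nhds_zero_nat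
  refine ⟨fun m => convolution ((φ m).normed volume) u (ContinuousLinearMap.lsmul ℝ ℝ) volume,
    fun m => ?_, fun m x => ?_, fun m x => ?_, ?_⟩
  · exact (φ m).hasCompactSupport_normed.contDiff_convolution_left _ (φ m).contDiff_normed
      hu.continuous.locallyIntegrable
  · rw [← Real.dist_eq]
    refine (φ m).dist_normed_convolution_le hu.continuous.aestronglyMeasurable fun y hy => ?_
    refine (hu.dist_le_mul y x).trans ?_
    rw [div_eq_mul_one_div]
    exact mul_le_mul_of_nonneg_left (Metric.mem_ball.1 hy).le K.coe_nonneg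
  · rw [(hderiv m x).fderiv, convolution_def]
    refine (norm_integral_le_integral_norm _).trans ?_
    have h1 : ∫ z, (φ m).normed volume z * (K : ℝ) = K := by
      rw [integral_mul_const, (φ m).integral_normed, one_mul]
    rw [← h1]
    refine integral_mono_of_nonneg (Filter.Eventually.of_forall fun z => norm_nonneg _)
      ((φ m).integrable_normed.mul_const _) (Filter.Eventually.of_forall fun z => ?_)
    simp only [ContinuousLinearMap.lsmul_apply, norm_smul]
    rw [norm_eq_abs, abs_of_nonneg ((φ m).nonneg_normed z)]
    exact mul_le_mul_of_nonneg_left (hDK _) ((φ m).nonneg_normed z)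
  · filter_upwards [ContDiffBump.ae_convolution_tendsto_right_of_locallyIntegrable (φ := φ)
      (K := 2) htend (Filter.Eventually.of_forall fun m => by
        change (1 : ℝ) / (m + 1) ≤ 2 * (1 / (2 * (m + 1)))
        field_simp; rfl) hDloc] with x hx
    refine hx.congr fun m => ?_
    rw [(hderiv m x).fderiv]

section LogConcaveWeight

variable {n : ℕ} {Ω : Set (EuclideanSpace ℝ (Fin n))} {ω : EuclideanSpace ℝ (Fin n) → ℝ}

lemma mulLogConcave_indicator (hΩc : Convex ℝ Ω) (hωpos : ∀ x ∈ Ω, 0 < ω x)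
    (hωlc : ConcaveOn ℝ Ω fun x => Real.log (ω x)) : MulLogConcave (Ω.indicator ω) := by
  have hnonneg : ∀ x, 0 ≤ Ω.indicator ω x :=
    fun x => Set.indicator_nonneg (fun y hy => (hωpos y hy).le) x
  intro x y s t hs ht hst
  by_cases hx : x ∈ Ω
  · by_cases hy : y ∈ Ω
    · have hxy := hΩc hx hy hs.le ht.le hst
      rw [Set.indicator_of_mem hx, Set.indicator_of_mem hy, Set.indicator_of_mem hxy,
        rpow_def_of_pos (hωpos x hx), rpow_def_of_pos (hωpos y hy), ← Real.exp_add,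
        ← Real.le_log_iff_exp_le (hωpos _ hxy)]
      have := hωlc.2 hx hy hs.le ht.le hst
      simp only [smul_eq_mul] at this
      linarith
    · rw [Set.indicator_of_notMem hy, zero_rpow ht.ne', mul_zero]
      exact hnonneg _
  · rw [Set.indicator_of_notMem hx, zero_rpow hs.ne', zero_mul]
    exact hnonneg _

lemma measurable_indicator_of_log_concaveOn (hΩo : IsOpen Ω) (hωpos : ∀ x ∈ Ω, 0 < ω x)
    (hωlc : ConcaveOn ℝ Ω fun x => Real.log (ω x)) : Measurable (Ω.indicator ω) := by
  have hc : ContinuousOn ω Ω := (hωlc.continuousOn hΩo).rexp.congr fun x hx =>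
    (Real.exp_log (hωpos x hx)).symm
  classical
  rw [← Set.piecewise_eq_indicator]
  exact hc.measurable_piecewise continuousOn_const hΩo.measurableSet

lemma exists_le_of_log_concaveOn (hΩo : IsOpen Ω) (hΩb : Bornology.IsBounded Ω)
    (hωpos : ∀ x ∈ Ω, 0 < ω x) (hωlc : ConcaveOn ℝ Ω fun x => Real.log (ω x)) :
    ∃ M, ∀ x ∈ Ω, ω x ≤ M := by
  rcases Ω.eq_empty_or_nonempty with rfl | ⟨x₀, hx₀⟩
  · exact ⟨0, fun x hx => absurd hx (Set.notMem_empty x)⟩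
  set f := fun x => Real.log (ω x) with hf
  have hnear : ∀ᶠ z in nhds x₀, z ∈ Ω ∧ f x₀ - 1 < f z :=
    (hΩo.eventually_mem hx₀).and
      (((hωlc.continuousOn hΩo).continuousAt (hΩo.mem_nhds hx₀)).eventually_const_lt (by linarith))
  obtain ⟨r, hr, hball⟩ := Metric.eventually_nhds_iff.1 hnear
  obtain ⟨d, hd⟩ := hΩb.exists_norm_le
  have hd0 : 0 ≤ d := (norm_nonneg _).trans (hd x₀ hx₀)
  set η := r / (2 * d + 1) with hη
  have hη0 : 0 < η := by positivity
  refine ⟨Real.exp (f x₀ + 1 / η), fun y hy => ?_⟩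
  rw [← Real.log_le_iff_le_exp (hωpos y hy)]
  have hyx : ‖y - x₀‖ ≤ 2 * d := by
    refine (norm_sub_le _ _).trans ?_
    linarith [hd y hy, hd x₀ hx₀]
  obtain ⟨hz, hfz⟩ := hball (y := x₀ - η • (y - x₀)) (by
    rw [dist_eq_norm, sub_sub_cancel_left, norm_neg, norm_smul, norm_eq_abs, abs_of_pos hη0]
    calc η * ‖y - x₀‖ ≤ η * (2 * d) := by gcongr
      _ < η * (2 * d + 1) := by nlinarith
      _ = r := div_mul_cancel₀ _ (by positivity))
  have h := hωlc.2 hz hy (by positivity : 0 ≤ 1 / (1 + η))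
    (by positivity : 0 ≤ η / (1 + η)) (by field_simp)
  have hx : (1 / (1 + η)) • (x₀ - η • (y - x₀)) + (η / (1 + η)) • y = x₀ := by
    have e : (1 / (1 + η)) • (x₀ - η • (y - x₀)) + (η / (1 + η)) • y
      = ((1 + η) / (1 + η)) • x₀ := by module
    rw [e, div_self (by positivity), one_smul]
  rw [hx] at h
  simp only [smul_eq_mul] at h
  change 1 / (1 + η) * f (x₀ - η • (y - x₀)) + η / (1 + η) * f y ≤ f x₀ at h
  have h2 : f (x₀ - η • (y - x₀)) + η * f y ≤ (1 + η) * f x₀ := by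
    have := mul_le_mul_of_nonneg_left h (by positivity : 0 ≤ 1 + η)
    have e : (1 + η) * (1 / (1 + η) * f (x₀ - η • (y - x₀)) + η / (1 + η) * f y)
        = f (x₀ - η • (y - x₀)) + η * f y := by field_simp
    rwa [e] at this
  change f y ≤ _
  have h3 : η * f y ≤ η * (f x₀ + 1 / η) := by
    rw [mul_add, mul_one_div_cancel hη0.ne']; linarith
  exact le_of_mul_le_mul_left h3 hη0

end LogConcaveWeight

theorem exists_rayleigh_le_of_lipschitzWith {n : ℕ} (hn : 0 < n) {p μ D M : ℝ} (hp : 1 < p)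
    (hμ : 0 < μ) (hD : 0 < D) (hμD : μ < (piP p / D) ^ p)
    {W : EuclideanSpace ℝ (Fin n) → ℝ} (hWlc : MulLogConcave W) (hWm : Measurable W)
    (hW0 : ∀ x, 0 ≤ W x) (hWM : ∀ x, W x ≤ M) {K₀ : Set (EuclideanSpace ℝ (Fin n))}
    (hK₀ : IsCompact K₀) (hK₀c : Convex ℝ K₀) (hK₀ne : K₀.Nonempty)
    (hWK : ∀ x, W x ≠ 0 → x ∈ K₀) (hKD : ∀ x ∈ K₀, ∀ y ∈ K₀, ‖x - y‖ ≤ D)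
    {L : NNReal} {u : EuclideanSpace ℝ (Fin n) → ℝ} (hu : LipschitzWith L u) :
    ∃ t, μ * ∫ x, |u x - t| ^ p * W x ≤ ∫ x, ‖fderiv ℝ u x‖ ^ p * W x := by
  have hp0 : 0 ≤ p := by linarith
  obtain ⟨v, hv, hvu, hvL, hvD⟩ := exists_contDiff_approx hu
  obtain ⟨C₀, hC₀⟩ := hK₀.exists_bound_of_continuousOn hu.continuous.continuousOn
  set C := C₀ + L with hC
  have hvuL : ∀ m x, |v m x - u x| ≤ L := fun m x => (hvu m x).trans
    (div_le_self L.coe_nonneg (by linarith [Nat.cast_nonneg (α := ℝ) m]))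
  have hvC : ∀ m, ∀ x ∈ K₀, |v m x| ≤ C := fun m x hx => by
    have h1 := abs_add_le (v m x - u x) (u x)
    rw [sub_add_cancel] at h1
    have h2 : |u x| ≤ C₀ := hC₀ x hx
    linarith [hvuL m x]
  choose t ht hle using fun m => exists_rayleigh_le_of_contDiff hn hp hμ hD hμD hWlc hWm hW0 hWM
    hK₀ hK₀c hK₀ne hWK hKD (hv m) (hvC m)
  obtain ⟨τ, -, ψ, hψ, hτ⟩ := isCompact_Icc.tendsto_subseq ht
  refine ⟨τ, ?_⟩
  have hWint : ∀ c : ℝ, Integrable fun x => c * W x := fun c =>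
    integrable_continuous_mul continuous_const hWm hW0 hWM hWK hK₀
  have hrpow : Continuous fun a : ℝ => a ^ p := continuous_rpow_const hp0
  have hl : Filter.Tendsto (fun m => ∫ x, |v (ψ m) x - t (ψ m)| ^ p * W x) Filter.atTop
      (nhds (∫ x, |u x - τ| ^ p * W x)) := by
    refine tendsto_integral_of_dominated_convergence (fun x => (2 * C) ^ p * W x) (fun m => ?_)
      (hWint _) (fun m => ?_) ?_
    · have := (hv (ψ m)).continuous
      exact ((hrpow.comp (this.sub continuous_const).abs).measurable.mul hWm).aestronglyMeasurable
    · refine Filter.Eventually.of_forall fun x => ?_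
      by_cases hx : W x = 0
      · simp [hx]
      · rw [norm_mul, norm_eq_abs (W x), abs_of_nonneg (hW0 x), norm_eq_abs,
          abs_of_nonneg (rpow_nonneg (abs_nonneg _) _)]
        refine mul_le_mul_of_nonneg_right (rpow_le_rpow (abs_nonneg _) ?_ hp0) (hW0 x)
        have h1 := abs_le.1 (hvC (ψ m) x (hWK x hx))
        have h2 := ht (ψ m)
        rw [abs_le]
        constructor <;> linarith [h1.1, h1.2, h2.1, h2.2]
    · refine Filter.Eventually.of_forall fun x => ?_
      have h1 : Filter.Tendsto (fun m => v m x) Filter.atTop (nhds (u x)) := by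
        rw [tendsto_iff_dist_tendsto_zero]
        refine squeeze_zero (fun _ => dist_nonneg) (fun m => ?_)
          (tendsto_const_div_atTop_nhds_zero_nat (L : ℝ) |>.comp (Filter.tendsto_add_atTop_nat 1))
        rw [Real.dist_eq]
        simpa using hvu m x
      exact ((hrpow.tendsto _).comp ((h1.comp hψ.tendsto_atTop).sub hτ).abs).mul_const (W x)
  have hr : Filter.Tendsto (fun m => ∫ x, ‖fderiv ℝ (v (ψ m)) x‖ ^ p * W x) Filter.atTop
      (nhds (∫ x, ‖fderiv ℝ u x‖ ^ p * W x)) := by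
    refine tendsto_integral_of_dominated_convergence (fun x => (L : ℝ) ^ p * W x) (fun m => ?_)
      (hWint _) (fun m => ?_) ?_
    · have := (measurable_fderiv ℝ (v (ψ m))).norm
      exact ((hrpow.measurable.comp this).mul hWm).aestronglyMeasurable
    · refine Filter.Eventually.of_forall fun x => ?_
      rw [norm_mul, norm_eq_abs (W x), abs_of_nonneg (hW0 x), norm_eq_abs,
        abs_of_nonneg (rpow_nonneg (norm_nonneg _) _)]
      exact mul_le_mul_of_nonneg_right (rpow_le_rpow (norm_nonneg _) (hvL _ x) hp0) (hW0 x)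
    · filter_upwards [hvD] with x hx
      exact ((hrpow.tendsto _).comp (hx.comp hψ.tendsto_atTop).norm).mul_const (W x)
  exact le_of_tendsto_of_tendsto' (hl.const_mul μ) hr fun m => hle (ψ m)

lemma norm_gradient_eq_norm_fderiv {E : Type*} [NormedAddCommGroup E] [InnerProductSpace ℝ E]
    [CompleteSpace E] (u : E → ℝ) (x : E) : ‖gradient u x‖ = ‖fderiv ℝ u x‖ :=
  LinearIsometryEquiv.norm_map _ _

/-- Weighted `L^p`-Poincaré inequality for log-concave weights with a diameter bound
(Ferone–Nitsch–Trombetti): for `p > 1`, an open bounded convex `Ω ⊂ ℝⁿ`, a positive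
log-concave integrable weight `ω` on `Ω`, and a Lipschitz function `u` on `Ω` with
`∫_Ω |u|^{p-2} u ω dx = 0`, one has
`∫_Ω |∇u|^p ω dx ≥ (π_p / diam Ω)^p · inf_t ∫_Ω |u - t|^p ω dx`. -/
theorem weighted_poincare_log_concave
    {n : ℕ} (p : ℝ) (hp : 1 < p)
    {Ω : Set (EuclideanSpace ℝ (Fin n))}
    (hΩo : IsOpen Ω) (hΩb : Bornology.IsBounded Ω) (hΩc : Convex ℝ Ω)
    (ω : EuclideanSpace ℝ (Fin n) → ℝ)
    (hωpos : ∀ x ∈ Ω, 0 < ω x)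
    (hωlc : ConcaveOn ℝ Ω fun x => Real.log (ω x))
    (hωint : IntegrableOn ω Ω)
    (u : EuclideanSpace ℝ (Fin n) → ℝ)
    (hLip : ∃ K : NNReal, LipschitzOnWith K u Ω)
    (hmean : ∫ x in Ω, |u x| ^ (p - 2) * u x * ω x = 0) :
    ∫ x in Ω, ‖gradient u x‖ ^ p * ω x
      ≥ (piP p / Metric.diam Ω) ^ p * ⨅ t : ℝ, ∫ x in Ω, |u x - t| ^ p * ω x := by
  have hp0 : 0 < p := by linarith
  set D := Metric.diam Ω with hDdef
  have hpos : ∀ t : ℝ, 0 ≤ ∫ x in Ω, |u x - t| ^ p * ω x := fun t =>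
    setIntegral_nonneg hΩo.measurableSet fun x hx =>
      mul_nonneg (rpow_nonneg (abs_nonneg _) _) (hωpos x hx).le
  have hLHS : 0 ≤ ∫ x in Ω, ‖gradient u x‖ ^ p * ω x :=
    setIntegral_nonneg hΩo.measurableSet fun x hx =>
      mul_nonneg (rpow_nonneg (norm_nonneg _) _) (hωpos x hx).le
  have hinf : 0 ≤ ⨅ t : ℝ, ∫ x in Ω, |u x - t| ^ p * ω x := Real.iInf_nonneg hpos
  rcases (Metric.diam_nonneg (s := Ω)).eq_or_lt with hD | hD
  · rw [← hDdef] at hD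
    rw [← hD, div_zero, zero_rpow hp0.ne', zero_mul]
    exact hLHS
  have hn : 0 < n := by
    rcases Nat.eq_zero_or_pos n with rfl | h
    · rw [Metric.diam_subsingleton Set.subsingleton_of_subsingleton] at hD
      exact absurd hD (lt_irrefl 0)
    · exact h
  have hne : Ω.Nonempty := by
    by_contra h
    rw [Set.not_nonempty_iff_eq_empty.1 h, Metric.diam_empty] at hD
    exact lt_irrefl 0 hD
  obtain ⟨L, hL⟩ := hLip
  obtain ⟨g, hg, hug⟩ := hL.extend_real
  obtain ⟨M, hM⟩ := exists_le_of_log_concaveOn hΩo hΩb hωpos hωlc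
  have hM0 : 0 ≤ M := by
    obtain ⟨z, hz⟩ := hne
    exact (hωpos z hz).le.trans (hM z hz)
  have hind : ∀ f f' : EuclideanSpace ℝ (Fin n) → ℝ, Set.EqOn f f' Ω →
      ∫ x in Ω, f x * ω x = ∫ x, f' x * Ω.indicator ω x := by
    intro f f' hff'
    rw [← integral_indicator hΩo.measurableSet]
    simp_rw [← Set.indicator_mul_right]
    congr 1
    refine Set.indicator_congr fun x hx => ?_
    rw [hff' hx]
  have key : ∀ μ, 0 < μ → μ < (piP p / D) ^ p →
      μ * (⨅ t : ℝ, ∫ x in Ω, |u x - t| ^ p * ω x) ≤ ∫ x in Ω, ‖gradient u x‖ ^ p * ω x := by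
    intro μ hμ hμD
    obtain ⟨t, ht⟩ := exists_rayleigh_le_of_lipschitzWith hn hp hμ hD hμD
      (mulLogConcave_indicator hΩc hωpos hωlc)
      (measurable_indicator_of_log_concaveOn hΩo hωpos hωlc)
      (fun x => Set.indicator_nonneg (fun y hy => (hωpos y hy).le) x)
      (Set.indicator_le' hM fun _ _ => hM0) hΩb.isCompact_closure hΩc.closure hne.closure
      (fun x hx => subset_closure (Set.mem_of_indicator_ne_zero hx))
      (fun x hx y hy => by
        rw [← dist_eq_norm, ← Metric.diam_closure]
        exact Metric.dist_le_diam_of_mem hΩb.closure hx hy) hg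
    rw [← hind (fun x => |u x - t| ^ p) _ fun x hx => by simp only [hug hx],
      ← hind (fun x => ‖gradient u x‖ ^ p) _ fun x hx => by
        have : u =ᶠ[nhds x] g := Filter.eventuallyEq_of_mem (hΩo.mem_nhds hx) hug
        simp only [norm_gradient_eq_norm_fderiv, this.fderiv_eq]] at ht
    exact (mul_le_mul_of_nonneg_left
      (ciInf_le ⟨0, by rintro _ ⟨s, rfl⟩; exact hpos s⟩ t) hμ.le).trans ht
  by_contra! hlt
  set I := ⨅ t : ℝ, ∫ x in Ω, |u x - t| ^ p * ω x with hI
  have hI0 : 0 < I := by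
    refine hinf.lt_of_ne fun h => ?_
    rw [← h, mul_zero] at hlt
    exact absurd hLHS (not_le.2 hlt)
  obtain ⟨μ, h1, h2⟩ := exists_between ((div_lt_iff₀ hI0).2 hlt)
  have := key μ ((div_nonneg hLHS hI0.le).trans_lt h1) h2
  rw [div_lt_iff₀ hI0] at h1
  exact absurd this (not_le.2 h1)
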